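/- arXiv:2401.00048 — 2 statements merged into one kernel-verified Lean document; each statement's English description precedes it below -/
import Mathlib

section
/- Assume the Reissner–Nordström radial setup stated in the context. Let p ≥ 2 be an integer, C₁ > 0, R > r₊, and δ ∈ (0, 1). There exist constants D₀ > 0, depending only on R, M, 𝐞, m, and C > 0, depending only on δ, p, C₁, R, M, 𝐞, m, such that for all sufficiently large integers L the following holds: if ω ∈ (0, m) satisfies L^{−p} ≤ m² − ω² ≤ C₁·L^{−2}, u is a weakly outgoing C² solution of u'' − V(ω, L, ·)·u = H, and H vanishes identically on the set {s : r(s) > R}, then ∫_{−∞}^{s(R)} [ (r/(r − r₊))·|u' + iωu|² + (1 + |s|^{1+δ})⁻¹·(|u'|² + |u|²) ] ds ≤ C·e^{D₀·L}·∫_{−∞}^{s(R)} (r/(r − r₊))·|H|² ds. -/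
open MeasureTheory Filter Set

/-- The radial Klein–Gordon potential on a subextremal Reissner–Nordström exterior,
expressed in the tortoise-type coordinate `s` via the inverse map `rofs = r(s)`. -/
noncomputable def Vpot (M m E : ℝ) (rofs : ℝ → ℝ) (ω : ℝ) (L : ℕ) (s : ℝ) : ℝ :=
  -ω ^ 2 + (1 - 2 * M / rofs s + E ^ 2 / rofs s ^ 2) *
    (m ^ 2 + ((L : ℝ) * ((L : ℝ) + 1)) / rofs s ^ 2 +
      (2 * M * rofs s - 2 * E ^ 2) / rofs s ^ 4)

/-- `u` is weakly outgoing: `u ∼ c·e^{−iωs}` (with its derivative) as `s → −∞`, and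
`u` together with `u'` decays exponentially as `s → +∞`. -/
def WeaklyOutgoing (ω : ℝ) (u : ℝ → ℂ) : Prop :=
  (∃ c : ℂ,
    Filter.Tendsto (fun s : ℝ => u s - c * Complex.exp (-Complex.I * (ω : ℂ) * (s : ℂ)))
      Filter.atBot (nhds 0) ∧
    Filter.Tendsto (fun s : ℝ =>
        deriv u s + Complex.I * (ω : ℂ) * c * Complex.exp (-Complex.I * (ω : ℂ) * (s : ℂ)))
      Filter.atBot (nhds 0)) ∧
  ∃ ε : ℝ, 0 < ε ∧
    Filter.Tendsto (fun s : ℝ => Real.exp (ε * s) * (‖u s‖ + ‖deriv u s‖))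
      Filter.atTop (nhds 0)

theorem antitoneOn_Iic_of_hasDerivAt_nonpos {f f' : ℝ → ℝ} {S : ℝ}
    (hf : ∀ s ≤ S, HasDerivAt f (f' s) s) (h : ∀ s ≤ S, f' s ≤ 0) : AntitoneOn f (Iic S) := by
  refine antitoneOn_of_deriv_nonpos (convex_Iic S)
    (fun s hs => (hf s hs).continuousAt.continuousWithinAt)
    (fun s hs => (hf s (mem_Iic.1 (interior_subset hs))).differentiableAt.differentiableWithinAt)
    (fun s hs => ?_)
  rw [(hf s (mem_Iic.1 (interior_subset hs))).deriv]
  exact h s (mem_Iic.1 (interior_subset hs))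

theorem Complex.real_inner_self_I_mul_add (w g : ℂ) (ω : ℝ) :
    inner ℝ w (Complex.I * ω * w + g) = inner ℝ w g := by
  simp [Complex.inner]
  ring

/-- If `w' = iωw + g` with `|g| ≤ Λ²q|u| + b`, where `u`, `w` are bounded and `w → 0` at `-∞`, then
`|w|²/q` is controlled near `-∞` by the weighted integral of `b²`. -/
theorem norm_sq_div_weight_le {w u g : ℝ → ℂ} {q q' b h : ℝ → ℝ} {S c Λ ω J B : ℝ}
    (hc : 0 < c) (hq : ∀ s ≤ S, 0 < q s) (hqd : ∀ s ≤ S, HasDerivAt q (q' s) s)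
    (hq' : ∀ s ≤ S, c * q s ≤ q' s) (hq0 : Tendsto q atBot (nhds 0))
    (hw : ∀ s ≤ S, HasDerivAt w (Complex.I * ω * w s + g s) s)
    (hg : ∀ s ≤ S, ‖g s‖ ≤ Λ ^ 2 * q s * ‖u s‖ + b s)
    (hu : ∀ s ≤ S, ‖u s‖ ≤ B) (hw0 : Tendsto w atBot (nhds 0))
    (hh : ∀ s ≤ S, HasDerivAt h (b s ^ 2 / q s) s)
    (hJ : ∀ s₀ s, s₀ ≤ s → s ≤ S → h s - h s₀ ≤ J) :
    ∀ s ≤ S, ‖w s‖ ^ 2 / q s ≤ 2 / c ^ 2 * (Λ ^ 4 * B ^ 2) * q s + 2 / c * J := by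
  set A := 2 / c ^ 2 * (Λ ^ 4 * B ^ 2) with hA
  have hη : ∀ η > 0, ∀ s ≤ S, ‖w s‖ ^ 2 / (q s + η) ≤ A * q s + 2 / c * J := by
    intro η hη s hs
    have hanti : AntitoneOn (fun s => ‖w s‖ ^ 2 / (q s + η) - A * q s - 2 / c * h s) (Iic S) := by
      refine antitoneOn_Iic_of_hasDerivAt_nonpos
        (fun s hs => ((((hw s hs).norm_sq.div ((hqd s hs).add_const η)
          (add_pos (hq s hs) hη).ne').sub ((hqd s hs).const_mul A)).sub
          ((hh s hs).const_mul (2 / c)))) (fun s hs => ?_)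
      have hqs := hq s hs
      have hqη : 0 < q s + η := add_pos hqs hη
      rw [Complex.real_inner_self_I_mul_add]
      have h1 : inner ℝ (w s) (g s) ≤ ‖w s‖ * (Λ ^ 2 * q s * B + b s) := by
        refine (real_inner_le_norm _ _).trans
          (mul_le_mul_of_nonneg_left ((hg s hs).trans ?_) (norm_nonneg _))
        have := hu s hs
        gcongr
      set x := ‖w s‖ / (q s + η) with hx
      have hxw : ‖w s‖ = x * (q s + η) := by rw [hx]; field_simp
      have hx0 : 0 ≤ x := by positivity
      have e1 : (2 * inner ℝ (w s) (g s) * (q s + η) - ‖w s‖ ^ 2 * q' s) / (q s + η) ^ 2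
          ≤ 2 * x * (Λ ^ 2 * q s * B + b s) - x ^ 2 * (c * q s) := by
        rw [div_le_iff₀ (by positivity)]
        have h2 := mul_le_mul_of_nonneg_left (hq' s hs) (sq_nonneg ‖w s‖)
        have h3 := mul_le_mul_of_nonneg_right h1 hqη.le
        rw [hxw] at h2 h3
        rw [hxw]
        nlinarith
      have e2 : 2 * x * (Λ ^ 2 * q s * B) ≤ c / 2 * x ^ 2 * q s + c * (A * q s) := by
        have : 0 ≤ q s / (2 * c) * (c * x - 2 * (Λ ^ 2 * B)) ^ 2 := by positivity
        have e : q s / (2 * c) * (c * x - 2 * (Λ ^ 2 * B)) ^ 2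
          = c / 2 * x ^ 2 * q s + c * (A * q s) - 2 * x * (Λ ^ 2 * q s * B) := by
          rw [hA]; field_simp; ring
        linarith
      have e3 : 2 * x * b s ≤ c / 2 * x ^ 2 * q s + 2 / c * (b s ^ 2 / q s) := by
        have : 0 ≤ (c * x * q s - 2 * b s) ^ 2 / (2 * c * q s) := by positivity
        have e : (c * x * q s - 2 * b s) ^ 2 / (2 * c * q s)
          = c / 2 * x ^ 2 * q s + 2 / c * (b s ^ 2 / q s) - 2 * x * b s := by
          field_simp; ring
        linarith
      have hA0 : 0 ≤ A := by positivity
      have e4 : c * (A * q s) ≤ A * q' s := by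
        nlinarith [mul_le_mul_of_nonneg_left (hq' s hs) hA0]
      linarith
    have hlim : Tendsto (fun s₀ => ‖w s₀‖ ^ 2 / (q s₀ + η) - A * q s₀) atBot (nhds 0) := by
      have : Tendsto (fun s₀ => ‖w s₀‖ ^ 2 / (q s₀ + η) - A * q s₀) atBot
          (nhds (‖(0 : ℂ)‖ ^ 2 / (0 + η) - A * 0)) :=
        ((hw0.norm.pow 2).div (hq0.add_const η) (by simpa using hη.ne')).sub (hq0.const_mul A)
      simpa using this
    have hle : ‖w s‖ ^ 2 / (q s + η) - A * q s - 2 / c * J ≤ 0 := by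
      refine ge_of_tendsto hlim ?_
      filter_upwards [Iic_mem_atBot s] with s₀ hs₀
      have h1 := hanti (mem_Iic.2 (le_trans hs₀ hs)) (mem_Iic.2 hs) hs₀
      have h2 := mul_le_mul_of_nonneg_left (hJ s₀ s hs₀ hs) (by positivity : 0 ≤ 2 / c)
      simp only at h1
      linarith
    linarith
  intro s hs
  have hlim : Tendsto (fun η => ‖w s‖ ^ 2 / (q s + η)) (nhdsWithin 0 (Ioi 0))
      (nhds (‖w s‖ ^ 2 / (q s + 0))) := by
    refine Tendsto.mono_left ?_ nhdsWithin_le_nhds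
    exact tendsto_const_nhds.div (tendsto_id.const_add _) (by simpa using (hq s hs).ne')
  rw [add_zero] at hlim
  exact le_of_tendsto hlim (eventually_nhdsWithin_of_forall fun η h => hη η h s hs)

/-- Grönwall estimate from `-∞` with the weighted energy `|w|²/q + Λ²|u|²`. -/
theorem weighted_energy_gronwall {w u g : ℝ → ℂ} {q q' b h d : ℝ → ℝ} {S c Λ Q ω J K : ℝ}
    (hc : 0 < c) (hΛ : 0 ≤ Λ) (hq : ∀ s ≤ S, 0 < q s) (hqQ : ∀ s ≤ S, q s ≤ Q)
    (hqd : ∀ s ≤ S, HasDerivAt q (q' s) s) (hq' : ∀ s ≤ S, c * q s ≤ q' s)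
    (hw : ∀ s ≤ S, HasDerivAt w (Complex.I * ω * w s + g s) s)
    (hu : ∀ s ≤ S, HasDerivAt u (w s - Complex.I * ω * u s) s)
    (hg : ∀ s ≤ S, ‖g s‖ ≤ Λ ^ 2 * q s * ‖u s‖ + b s)
    (hh : ∀ s ≤ S, HasDerivAt h (b s ^ 2 / q s) s)
    (hJ : ∀ s₀ s, s₀ ≤ s → s ≤ S → h s - h s₀ ≤ J)
    (hd : ∀ s ≤ S, HasDerivAt d (‖w s‖ ^ 2 / q s) s)
    (hK : ∀ ε > 0, ∀ᶠ s in atBot, ‖w s‖ ^ 2 / q s + Λ ^ 2 * ‖u s‖ ^ 2 ≤ K + ε) :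
    ∀ s₀ s, s₀ ≤ s → s ≤ S →
      ‖w s‖ ^ 2 / q s + Λ ^ 2 * ‖u s‖ ^ 2 + c / 2 * (d s - d s₀)
        ≤ Real.exp (4 * Λ / c * √Q) * (K + 2 / c * J) := by
  set Γ := 4 * Λ / c * √Q with hΓ
  set k := 4 * Λ / c with hk
  have hk0 : 0 ≤ k := by positivity
  have hanti : AntitoneOn (fun s => Real.exp (-(k * √(q s))) *
      (‖w s‖ ^ 2 / q s + Λ ^ 2 * ‖u s‖ ^ 2) + c / 2 * Real.exp (-Γ) * d s - 2 / c * h s) (Iic S) := by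
    refine antitoneOn_Iic_of_hasDerivAt_nonpos
      (fun s hs => (((((hqd s hs).sqrt (hq s hs).ne').const_mul k).neg.exp.mul
        (((hw s hs).norm_sq.div (hqd s hs) (hq s hs).ne').add
          ((hu s hs).norm_sq.const_mul (Λ ^ 2)))).add
        ((hd s hs).const_mul (c / 2 * Real.exp (-Γ)))).sub
        ((hh s hs).const_mul (2 / c))) (fun s hs => ?_)
    have hqs := hq s hs
    simp only [Pi.neg_apply, Pi.add_apply, Pi.div_apply]
    rw [Complex.real_inner_self_I_mul_add]
    have hi2 : inner ℝ (u s) (w s - Complex.I * ω * u s) = inner ℝ (u s) (w s) := by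
      have := Complex.real_inner_self_I_mul_add (u s) (w s) (-ω)
      rw [← this]; congr 1; push_cast; ring
    rw [hi2]
    have h1 : inner ℝ (w s) (g s) ≤ ‖w s‖ * (Λ ^ 2 * q s * ‖u s‖ + b s) :=
      (real_inner_le_norm _ _).trans (mul_le_mul_of_nonneg_left (hg s hs) (norm_nonneg _))
    have h2 : inner ℝ (u s) (w s) ≤ ‖u s‖ * ‖w s‖ := real_inner_le_norm _ _
    set G := Real.exp (-(k * √(q s))) with hG
    have hG0 : 0 < G := Real.exp_pos _
    have hG1 : G ≤ 1 := Real.exp_le_one_iff.2 (by simp; positivity)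
    have hG2 : Real.exp (-Γ) ≤ G := by
      rw [hG, Real.exp_le_exp, hΓ, neg_le_neg_iff]
      have := Real.sqrt_le_sqrt (hqQ s hs)
      gcongr
    set ρ := √(q s) with hρ
    have hρ0 : 0 < ρ := Real.sqrt_pos.2 hqs
    have hρq : q s = ρ ^ 2 := (Real.sq_sqrt hqs.le).symm
    set x := ‖w s‖ / ρ with hx
    have hxw : ‖w s‖ = x * ρ := by rw [hx]; field_simp
    have hx0 : 0 ≤ x := by positivity
    have hD : ‖w s‖ ^ 2 / q s = x ^ 2 := by rw [hxw, hρq]; field_simp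
    set y := Λ * ‖u s‖ with hy
    have hy2 : Λ ^ 2 * ‖u s‖ ^ 2 = y ^ 2 := by rw [hy]; ring
    rw [hD, hy2]
    have hq's := hq' s hs
    have e1 : (2 * inner ℝ (w s) (g s) * q s - ‖w s‖ ^ 2 * q' s) / q s ^ 2
        ≤ 2 * Λ * ρ * x * y + 2 * x * b s / ρ - c * x ^ 2 := by
      rw [div_le_iff₀ (by positivity)]
      have h3 := mul_le_mul_of_nonneg_left hq's (sq_nonneg ‖w s‖)
      have h4 := mul_le_mul_of_nonneg_right h1 hqs.le
      have e : (2 * Λ * ρ * x * y + 2 * x * b s / ρ - c * x ^ 2) * q s ^ 2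
        = 2 * (‖w s‖ * (Λ ^ 2 * q s * ‖u s‖ + b s) * q s) - ‖w s‖ ^ 2 * (c * q s) := by
        rw [hxw, hρq, hy]; field_simp
      rw [e]; linarith
    have e2 : Λ ^ 2 * (2 * inner ℝ (u s) (w s)) ≤ 2 * Λ * ρ * x * y := by
      have e : 2 * Λ * ρ * x * y = Λ ^ 2 * (2 * (‖u s‖ * ‖w s‖)) := by rw [hxw, hy]; ring
      rw [e]; gcongr
    have e3 : 2 * x * b s / ρ ≤ c / 2 * x ^ 2 + 2 / c * (b s ^ 2 / q s) := by
      have : 0 ≤ (c * x * ρ - 2 * b s) ^ 2 / (2 * c * ρ ^ 2) := by positivity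
      have e : (c * x * ρ - 2 * b s) ^ 2 / (2 * c * ρ ^ 2)
        = c / 2 * x ^ 2 + 2 / c * (b s ^ 2 / q s) - 2 * x * b s / ρ := by
        rw [hρq]; field_simp; ring
      linarith
    have e4 : 4 * Λ * ρ * x * y ≤ 2 * Λ * ρ * (x ^ 2 + y ^ 2) := by
      have : 0 ≤ 2 * Λ * ρ * (x - y) ^ 2 := by positivity
      linarith
    have e5 : 2 * Λ * ρ ≤ k * (q' s / (2 * ρ)) := by
      have e : 2 * Λ * ρ = k * (c * q s / (2 * ρ)) := by rw [hk, hρq]; field_simp; ring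
      rw [e]; gcongr
    have e6 := mul_le_mul_of_nonneg_right e5 (by positivity : 0 ≤ x ^ 2 + y ^ 2)
    have e7 := mul_le_mul_of_nonneg_right hG2 (by positivity : 0 ≤ c / 2 * x ^ 2)
    have hb : 0 ≤ 2 / c * (b s ^ 2 / q s) := by positivity
    have e8 := mul_le_mul_of_nonneg_right hG1 hb
    have e9 : G * ((2 * inner ℝ (w s) (g s) * q s - ‖w s‖ ^ 2 * q' s) / q s ^ 2 +
        Λ ^ 2 * (2 * inner ℝ (u s) (w s)))
        ≤ G * (k * (q' s / (2 * ρ)) * (x ^ 2 + y ^ 2) - c / 2 * x ^ 2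
          + 2 / c * (b s ^ 2 / q s)) := by
      apply mul_le_mul_of_nonneg_left _ hG0.le
      linarith
    nlinarith
  intro s₀ s hs₀ hs
  have hdm : AntitoneOn (fun s => -d s) (Iic S) := by
    refine antitoneOn_Iic_of_hasDerivAt_nonpos (fun s hs => (hd s hs).neg) (fun s hs => ?_)
    have := hq s hs
    simp only [Left.neg_nonpos_iff]; positivity
  refine le_of_forall_pos_le_add fun ε hε => ?_
  have hε' : 0 < Real.exp (-Γ) * ε := by positivity
  obtain ⟨t, ht1, ht2⟩ := ((hK _ hε').and (Iic_mem_atBot s₀)).exists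
  have htS : t ≤ S := (mem_Iic.1 ht2).trans (hs₀.trans hs)
  have h1 := hanti (mem_Iic.2 htS) (mem_Iic.2 hs) ((mem_Iic.1 ht2).trans hs₀)
  have h2 := hdm (mem_Iic.2 htS) (mem_Iic.2 (hs₀.trans hs)) ht2
  have h3 := mul_le_mul_of_nonneg_left (hJ t s ((mem_Iic.1 ht2).trans hs₀) hs)
    (by positivity : 0 ≤ 2 / c)
  simp only at h1 h2
  have hnn : ∀ t ≤ S, 0 ≤ ‖w t‖ ^ 2 / q t + Λ ^ 2 * ‖u t‖ ^ 2 := fun t ht => by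
    have := hq t ht
    positivity
  have h4 : Real.exp (-(k * √(q t))) * (‖w t‖ ^ 2 / q t + Λ ^ 2 * ‖u t‖ ^ 2) ≤
      1 * (‖w t‖ ^ 2 / q t + Λ ^ 2 * ‖u t‖ ^ 2) :=
    mul_le_mul_of_nonneg_right (Real.exp_le_one_iff.2 (by simp; positivity)) (hnn t htS)
  have h5 : Real.exp (-Γ) * (‖w s‖ ^ 2 / q s + Λ ^ 2 * ‖u s‖ ^ 2) ≤
      Real.exp (-(k * √(q s))) * (‖w s‖ ^ 2 / q s + Λ ^ 2 * ‖u s‖ ^ 2) := by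
    refine mul_le_mul_of_nonneg_right ?_ (hnn s hs)
    rw [Real.exp_le_exp, hΓ, neg_le_neg_iff]
    have := Real.sqrt_le_sqrt (hqQ s hs)
    gcongr
  have h6 := mul_le_mul_of_nonneg_left h2 (by positivity : 0 ≤ c / 2 * Real.exp (-Γ))
  have h7 : Real.exp (-Γ) * (‖w s‖ ^ 2 / q s + Λ ^ 2 * ‖u s‖ ^ 2 + c / 2 * (d s - d s₀))
      ≤ K + 2 / c * J + Real.exp (-Γ) * ε := by linarith
  have h8 := mul_le_mul_of_nonneg_left h7 (Real.exp_pos Γ).le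
  have h9 : Real.exp Γ * Real.exp (-Γ) = 1 := by rw [← Real.exp_add]; simp
  calc _ = Real.exp Γ * (Real.exp (-Γ) * (‖w s‖ ^ 2 / q s + Λ ^ 2 * ‖u s‖ ^ 2 + c / 2 * (d s - d s₀))) := by
        rw [← mul_assoc, h9, one_mul]
    _ ≤ _ := h8
    _ = _ := by rw [mul_add _ _ (Real.exp (-Γ) * ε), ← mul_assoc _ _ ε, h9, one_mul]

/-- The flux identity bounds the amplitude at `-∞` of a solution that decays at `+∞`. -/
theorem flux_amplitude_le {u v H : ℝ → ℂ} {W q q' h : ℝ → ℝ} {S c Q ω J a X ε : ℝ}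
    (hc : 0 < c) (hq : ∀ s ≤ S, 0 < q s) (hqQ : ∀ s ≤ S, q s ≤ Q)
    (hqd : ∀ s ≤ S, HasDerivAt q (q' s) s) (hq' : ∀ s ≤ S, c * q s ≤ q' s)
    (hu : ∀ s, HasDerivAt u (v s) s)
    (hv : ∀ s, HasDerivAt v (((W s - ω ^ 2 : ℝ) : ℂ) * u s + H s) s)
    (hH : ∀ s, S < s → H s = 0)
    (hh : ∀ s ≤ S, HasDerivAt h (‖H s‖ ^ 2 / q s) s)
    (hJ : ∀ s₀ s, s₀ ≤ s → s ≤ S → h s - h s₀ ≤ J)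
    (hu0 : Tendsto u atTop (nhds 0)) (hv0 : Tendsto v atTop (nhds 0))
    (hua : Tendsto (fun s => ‖u s‖) atBot (nhds a))
    (hw0 : Tendsto (fun s => v s + Complex.I * ω * u s) atBot (nhds 0))
    (hX : ∀ s ≤ S, ‖u s‖ ^ 2 ≤ X) (hε : 0 < ε) :
    ω * a ^ 2 ≤ ε * X * Q / c + J / (4 * ε) := by
  have hX0 : 0 ≤ X := (sq_nonneg _).trans (hX S le_rfl)
  set F : ℝ → ℝ := fun s => inner ℝ (Complex.I * u s) (v s) with hF
  have hFd : ∀ s, HasDerivAt F (inner ℝ (Complex.I * u s) (H s)) s := by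
    intro s
    have := ((hu s).const_mul Complex.I).inner ℝ (hv s)
    refine this.congr_deriv ?_
    generalize W s - ω ^ 2 = x
    simp [Complex.inner]
    ring
  have hFS : 0 ≤ F S := by
    have hanti : AntitoneOn F (Ici S) := by
      refine antitoneOn_of_deriv_nonpos (convex_Ici S)
        (fun s _ => (hFd s).continuousAt.continuousWithinAt)
        (fun s _ => (hFd s).differentiableAt.differentiableWithinAt) (fun s hs => ?_)
      rw [interior_Ici] at hs
      rw [(hFd s).deriv, hH s hs, inner_zero_right]
    have hlim : Tendsto F atTop (nhds 0) := by
      have : Tendsto F atTop (nhds (inner ℝ (Complex.I * 0) (0 : ℂ))) :=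
        (hu0.const_mul Complex.I).inner hv0
      simpa using this
    refine le_of_tendsto hlim ?_
    filter_upwards [Ici_mem_atTop S] with t ht
    exact hanti (mem_Ici.2 le_rfl) ht ht
  have hanti : AntitoneOn (fun s => F s - ε * X / c * q s - 1 / (4 * ε) * h s) (Iic S) := by
    refine antitoneOn_Iic_of_hasDerivAt_nonpos
      (fun s hs => (((hFd s).sub ((hqd s hs).const_mul (ε * X / c))).sub
        ((hh s hs).const_mul (1 / (4 * ε))))) (fun s hs => ?_)
    have hqs := hq s hs
    have h1 : inner ℝ (Complex.I * u s) (H s) ≤ ‖u s‖ * ‖H s‖ := by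
      simpa using real_inner_le_norm (Complex.I * u s) (H s)
    have h2 : ‖u s‖ * ‖H s‖ ≤ ε * q s * ‖u s‖ ^ 2 + 1 / (4 * ε) * (‖H s‖ ^ 2 / q s) := by
      have : 0 ≤ (2 * ε * q s * ‖u s‖ - ‖H s‖) ^ 2 / (4 * ε * q s) := by positivity
      have e : (2 * ε * q s * ‖u s‖ - ‖H s‖) ^ 2 / (4 * ε * q s)
        = ε * q s * ‖u s‖ ^ 2 + 1 / (4 * ε) * (‖H s‖ ^ 2 / q s) - ‖u s‖ * ‖H s‖ := by
        field_simp; ring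
      linarith
    have h3 : ε * q s * ‖u s‖ ^ 2 ≤ ε * X / c * q' s := by
      calc ε * q s * ‖u s‖ ^ 2 ≤ ε * q s * X := by gcongr; exact hX s hs
        _ = ε * X / c * (c * q s) := by field_simp
        _ ≤ _ := by gcongr; exact hq' s hs
    linarith
  have hlim : Tendsto (fun s => -F s) atBot (nhds (ω * a ^ 2)) := by
    have hz : Tendsto (fun s => ‖u s‖ * ‖v s + Complex.I * ω * u s‖) atBot (nhds (a * ‖(0 : ℂ)‖)) :=
      hua.mul hw0.norm
    rw [norm_zero, mul_zero] at hz
    have hz2 : Tendsto (fun s => inner ℝ (Complex.I * u s) (v s + Complex.I * ω * u s))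
        atBot (nhds 0) := by
      refine squeeze_zero_norm (fun s => ?_) hz
      refine (norm_inner_le_norm _ _).trans ?_
      rw [norm_mul, Complex.norm_I, one_mul]
    have := ((hua.pow 2).const_mul ω).sub hz2
    rw [sub_zero] at this
    refine this.congr fun s => ?_
    rw [hF, ← Complex.normSq_eq_norm_sq]
    simp [Complex.inner, Complex.normSq_apply]
    ring
  refine le_of_tendsto hlim ?_
  filter_upwards [Iic_mem_atBot S] with t ht
  have h1 := hanti ht (mem_Iic.2 le_rfl) ht
  have h2 := mul_le_mul_of_nonneg_left (hJ t S ht le_rfl) (by positivity : 0 ≤ 1 / (4 * ε))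
  have h3 : 0 ≤ ε * X / c * q t := by have := hq t ht; positivity
  have h4 : ε * X / c * q S ≤ ε * X / c * Q := by gcongr; exact hqQ S le_rfl
  have h5 : ε * X / c * Q = ε * X * Q / c := by ring
  have h6 : J / (4 * ε) = 1 / (4 * ε) * J := by ring
  simp only at h1
  rw [h6, ← h5]
  linarith

/-- A solution that is outgoing at `-∞` and decays at `+∞` is controlled by its source with a loss
that is exponential in `Λ`, where `Λ²q` dominates the potential barrier. -/
theorem outgoing_solution_bound {u v H : ℝ → ℂ} {W q q' h d : ℝ → ℝ} {S c Λ Q ω J a μ : ℝ}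
    (hc : 0 < c) (hΛ : 1 ≤ Λ) (hμ : 0 < μ) (hω : μ ≤ ω)
    (hq : ∀ s ≤ S, 0 < q s) (hqQ : ∀ s ≤ S, q s ≤ Q)
    (hqd : ∀ s ≤ S, HasDerivAt q (q' s) s) (hq' : ∀ s ≤ S, c * q s ≤ q' s)
    (hq0 : Tendsto q atBot (nhds 0)) (hW : ∀ s ≤ S, |W s| ≤ Λ ^ 2 * q s)
    (hu : ∀ s, HasDerivAt u (v s) s)
    (hv : ∀ s, HasDerivAt v (((W s - ω ^ 2 : ℝ) : ℂ) * u s + H s) s)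
    (hH : ∀ s, S < s → H s = 0)
    (hh : ∀ s ≤ S, HasDerivAt h (‖H s‖ ^ 2 / q s) s)
    (hJ : ∀ s₀ s, s₀ ≤ s → s ≤ S → h s - h s₀ ≤ J)
    (hd : ∀ s ≤ S, HasDerivAt d (‖v s + Complex.I * ω * u s‖ ^ 2 / q s) s)
    (hu0 : Tendsto u atTop (nhds 0)) (hv0 : Tendsto v atTop (nhds 0))
    (hua : Tendsto (fun s => ‖u s‖) atBot (nhds a))
    (hw0 : Tendsto (fun s => v s + Complex.I * ω * u s) atBot (nhds 0)) :
    ∀ s₀ s, s₀ ≤ s → s ≤ S →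
      ‖u s‖ ^ 2 + c / 2 * (d s - d s₀)
        ≤ (8 / c + Q / (μ ^ 2 * c)) * Λ ^ 2 * Real.exp (4 * Λ / c * √Q) ^ 2 * J := by
  have hJ0 : 0 ≤ J := by simpa using hJ S S le_rfl le_rfl
  have hQ0 : 0 < Q := (hq S le_rfl).trans_le (hqQ S le_rfl)
  have hω0 : 0 < ω := hμ.trans_le hω
  have hΛ0 : 0 < Λ := by linarith
  set w : ℝ → ℂ := fun s => v s + Complex.I * ω * u s with hwdef
  set g : ℝ → ℂ := fun s => (W s : ℂ) * u s + H s with hgdef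
  have hwd : ∀ s ≤ S, HasDerivAt w (Complex.I * ω * w s + g s) s := by
    intro s _
    refine ((hv s).add ((hu s).const_mul (Complex.I * ω))).congr_deriv ?_
    simp only [hwdef, hgdef]
    push_cast
    linear_combination (-(ω ^ 2 * u s : ℂ)) * Complex.I_sq
  have hud : ∀ s ≤ S, HasDerivAt u (w s - Complex.I * ω * u s) s := by
    intro s _
    simpa [hwdef] using hu s
  have hg : ∀ s ≤ S, ‖g s‖ ≤ Λ ^ 2 * q s * ‖u s‖ + ‖H s‖ := by
    intro s hs
    refine (norm_add_le _ _).trans ?_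
    rw [norm_mul, Complex.norm_real, Real.norm_eq_abs]
    have := hW s hs
    gcongr
  have hK : ∀ ε > 0, ∀ᶠ s in atBot,
      ‖w s‖ ^ 2 / q s + Λ ^ 2 * ‖u s‖ ^ 2 ≤ (2 / c * J + Λ ^ 2 * a ^ 2) + ε := by
    intro ε hε
    obtain ⟨t, ht⟩ := eventually_atBot.1 (hua.eventually (gt_mem_nhds (lt_add_one a)))
    have hmS : ∀ s ≤ min t S, s ≤ S := fun s hs => hs.trans (min_le_right _ _)
    have hA := norm_sq_div_weight_le (S := min t S) (B := a + 1) hc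
      (fun s hs => hq s (hmS s hs)) (fun s hs => hqd s (hmS s hs)) (fun s hs => hq' s (hmS s hs))
      hq0 (fun s hs => hwd s (hmS s hs)) (fun s hs => hg s (hmS s hs))
      (fun s hs => (ht s (hs.trans (min_le_left _ _))).le) hw0 (fun s hs => hh s (hmS s hs))
      (fun s₀ s h1 h2 => hJ s₀ s h1 (hmS s h2))
    have hlim : Tendsto (fun s => 2 / c ^ 2 * (Λ ^ 4 * (a + 1) ^ 2) * q s + 2 / c * J +
        Λ ^ 2 * ‖u s‖ ^ 2) atBot
        (nhds (2 / c ^ 2 * (Λ ^ 4 * (a + 1) ^ 2) * 0 + 2 / c * J + Λ ^ 2 * a ^ 2)) :=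
      ((hq0.const_mul _).add_const _).add ((hua.pow 2).const_mul _)
    filter_upwards [hlim.eventually (gt_mem_nhds (lt_add_of_pos_right _ hε)),
      Iic_mem_atBot (min t S)] with s h1 h2
    have := hA s h2
    linarith
  have hmain := weighted_energy_gronwall hc hΛ0.le hq hqQ hqd hq' hwd hud hg hh hJ hd hK
  set G := Real.exp (4 * Λ / c * √Q) with hG
  have hG1 : 1 ≤ G := Real.one_le_exp (by positivity)
  have hG0 : 0 < G := by linarith
  set X := G * (4 / c * J + Λ ^ 2 * a ^ 2) with hXdef
  have hX : ∀ s₀ s, s₀ ≤ s → s ≤ S → ‖u s‖ ^ 2 + c / 2 * (d s - d s₀) ≤ X ∧ 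
      Λ ^ 2 * ‖u s‖ ^ 2 ≤ X := by
    intro s₀ s h1 h2
    have h3 := hmain s₀ s h1 h2
    have h3' := hmain s s le_rfl h2
    have e : G * (2 / c * J + Λ ^ 2 * a ^ 2 + 2 / c * J) = X := by rw [hXdef]; ring
    rw [e] at h3 h3'
    have h4 : 0 ≤ ‖w s‖ ^ 2 / q s := by have := hq s h2; positivity
    have h5 : 0 ≤ (Λ ^ 2 - 1) * ‖u s‖ ^ 2 := by
      have : 1 ≤ Λ ^ 2 := one_le_pow₀ hΛ
      have : 0 ≤ Λ ^ 2 - 1 := by linarith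
      positivity
    constructor <;> linarith
  have hflux := flux_amplitude_le (X := X / Λ ^ 2) (ε := ω * c / (2 * Q * G)) hc hq hqQ hqd hq'
    hu hv hH hh hJ hu0 hv0 hua hw0
    (fun s hs => by
      rw [le_div_iff₀ (by positivity), mul_comm]; exact (hX s s le_rfl hs).2) (by positivity)
  have ha : a ^ 2 ≤ (4 / (c * Λ ^ 2) + Q * G / (ω ^ 2 * c)) * J := by
    have e : ω * c / (2 * Q * G) * (X / Λ ^ 2) * Q / c + J / (4 * (ω * c / (2 * Q * G)))
      = ω / 2 * ((4 / (c * Λ ^ 2) + Q * G / (ω ^ 2 * c)) * J) + ω / 2 * a ^ 2 := by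
      rw [hXdef]; field_simp; ring
    rw [e] at hflux
    have : ω / 2 * a ^ 2 ≤ ω / 2 * ((4 / (c * Λ ^ 2) + Q * G / (ω ^ 2 * c)) * J) := by linarith
    exact le_of_mul_le_mul_left this (by positivity)
  intro s₀ s h1 h2
  refine (hX s₀ s h1 h2).1.trans ?_
  have hΛ2 : 1 ≤ Λ ^ 2 := one_le_pow₀ hΛ
  have hωμ : Q * G / (ω ^ 2 * c) ≤ Q * G / (μ ^ 2 * c) := by gcongr
  have h3 : Λ ^ 2 * a ^ 2 ≤ (4 / c + Λ ^ 2 * (Q * G / (μ ^ 2 * c))) * J := by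
    calc Λ ^ 2 * a ^ 2 ≤ Λ ^ 2 * ((4 / (c * Λ ^ 2) + Q * G / (ω ^ 2 * c)) * J) := by gcongr
      _ ≤ Λ ^ 2 * ((4 / (c * Λ ^ 2) + Q * G / (μ ^ 2 * c)) * J) := by gcongr
      _ = _ := by field_simp
  have h4 : 8 / c ≤ 8 / c * (Λ ^ 2 * G) := by
    have : 1 ≤ Λ ^ 2 * G := one_le_mul_of_one_le_of_one_le hΛ2 hG1
    exact le_mul_of_one_le_right (by positivity) this
  have hQn : 0 ≤ Λ ^ 2 * (Q * G / (μ ^ 2 * c)) := by positivity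
  calc X ≤ G * (4 / c * J + (4 / c + Λ ^ 2 * (Q * G / (μ ^ 2 * c))) * J) := by
        rw [hXdef]; gcongr
    _ = G * ((8 / c + Λ ^ 2 * (Q * G / (μ ^ 2 * c))) * J) := by ring
    _ ≤ G * ((8 / c * (Λ ^ 2 * G) + Λ ^ 2 * (Q * G / (μ ^ 2 * c))) * J) := by
        gcongr
    _ = _ := by ring

theorem intervalIntegral_le_toReal_lintegral_Iic {F : ℝ → ℝ} (hF : Continuous F)
    (hF0 : ∀ s, 0 ≤ F s) {S : ℝ} (hfin : ∫⁻ s in Iic S, ENNReal.ofReal (F s) ≠ ⊤) {s₀ s : ℝ}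
    (h0 : s₀ ≤ s) (hs : s ≤ S) :
    ∫ x in s₀..s, F x ≤ (∫⁻ s in Iic S, ENNReal.ofReal (F s)).toReal := by
  rw [← ENNReal.ofReal_le_iff_le_toReal hfin, intervalIntegral.integral_of_le h0,
    ofReal_integral_eq_lintegral_ofReal
      ((hF.integrableOn_Icc (a := s₀) (b := s)).mono_set Ioc_subset_Icc_self)
      (Eventually.of_forall hF0)]
  exact lintegral_mono_set fun x hx => hx.2.trans hs

theorem lintegral_Iic_le_of_intervalIntegral_le {F : ℝ → ℝ} (hF : Continuous F)
    (hF0 : ∀ s, 0 ≤ F s) {S B : ℝ} (hB : ∀ s₀ ≤ S, ∫ x in s₀..S, F x ≤ B) :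
    ∫⁻ s in Iic S, ENNReal.ofReal (F s) ≤ ENNReal.ofReal B := by
  have hFi : IntegrableOn F (Iic S) := by
    refine integrableOn_Iic_of_intervalIntegral_norm_bounded (l := atBot) (a := id) B S
      (fun i => (hF.integrableOn_Icc (a := i) (b := S)).mono_set Ioc_subset_Icc_self) tendsto_id ?_
    filter_upwards [Iic_mem_atBot S] with t ht
    simp only [id, Real.norm_eq_abs, abs_of_nonneg (hF0 _)]
    exact hB t ht
  rw [← ofReal_integral_eq_lintegral_ofReal hFi (Eventually.of_forall hF0)]
  refine ENNReal.ofReal_le_ofReal ?_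
  refine le_of_tendsto (intervalIntegral_tendsto_integral_Iic S hFi tendsto_id) ?_
  filter_upwards [Iic_mem_atBot S] with t ht using hB t ht

theorem Continuous.hasDerivAt_intervalIntegral {F : ℝ → ℝ} (hF : Continuous F) (a b : ℝ) :
    HasDerivAt (fun t => ∫ x in a..t, F x) (F b) b :=
  intervalIntegral.integral_hasDerivAt_right (hF.intervalIntegrable _ _)
    hF.stronglyMeasurable.stronglyMeasurableAtFilter hF.continuousAt

section Tortoise

variable {rm rp κ : ℝ} {rofs : ℝ → ℝ}

theorem tortoise_sub_ge (hrmp : rm < rp) (hκ : 0 < κ) {x y : ℝ} (hx : rp < x) (hxy : x ≤ y) :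
    y - x ≤ (y + (2 * κ)⁻¹ * Real.log ((y - rm) * (y - rp))) -
      (x + (2 * κ)⁻¹ * Real.log ((x - rm) * (x - rp))) := by
  have h1 : 0 < (x - rm) * (x - rp) := mul_pos (by linarith) (by linarith)
  have h2 : Real.log ((x - rm) * (x - rp)) ≤ Real.log ((y - rm) * (y - rp)) := by
    refine Real.log_le_log h1 (mul_le_mul (by linarith) (by linarith) (by linarith) (by linarith))
  have h3 := mul_le_mul_of_nonneg_left h2 (by positivity : 0 ≤ (2 * κ)⁻¹)
  linarith

theorem le_tortoise_iff (hrmp : rm < rp) (hκ : 0 < κ) (hr1 : ∀ s, rp < rofs s)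
    (hr2 : ∀ s, rofs s + (2 * κ)⁻¹ * Real.log ((rofs s - rm) * (rofs s - rp)) = s)
    {R : ℝ} (hR : rp < R) (s : ℝ) :
    s ≤ R + (2 * κ)⁻¹ * Real.log ((R - rm) * (R - rp)) ↔ rofs s ≤ R := by
  constructor
  · intro h
    by_contra! hlt
    have := tortoise_sub_ge hrmp hκ hR hlt.le
    rw [hr2] at this
    linarith
  · intro h
    have := tortoise_sub_ge hrmp hκ (hr1 s) h
    rw [hr2] at this
    linarith

theorem tortoise_inverse_continuous (hrmp : rm < rp) (hκ : 0 < κ) (hr1 : ∀ s, rp < rofs s)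
    (hr2 : ∀ s, rofs s + (2 * κ)⁻¹ * Real.log ((rofs s - rm) * (rofs s - rp)) = s) :
    Continuous rofs := by
  have key : ∀ s t, rofs s ≤ rofs t → rofs t - rofs s ≤ t - s := by
    intro s t h
    have := tortoise_sub_ge hrmp hκ (hr1 s) h
    rwa [hr2, hr2] at this
  refine (LipschitzWith.of_dist_le_mul (K := 1) fun s t => ?_).continuous
  rw [NNReal.coe_one, one_mul, Real.dist_eq, Real.dist_eq]
  rcases le_total (rofs s) (rofs t) with h | h
  · rw [abs_sub_comm, abs_of_nonneg (by linarith), abs_sub_comm s]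
    exact (key s t h).trans (le_abs_self _)
  · rw [abs_of_nonneg (by linarith)]
    exact (key t s h).trans (le_abs_self _)

theorem tortoise_inverse_hasDerivAt (hrmp : rm < rp) (hκ : 0 < κ) (hr1 : ∀ s, rp < rofs s)
    (hr2 : ∀ s, rofs s + (2 * κ)⁻¹ * Real.log ((rofs s - rm) * (rofs s - rp)) = s) (s : ℝ) :
    HasDerivAt rofs (1 + (2 * κ)⁻¹ * ((rofs s - rp + (rofs s - rm)) /
      ((rofs s - rm) * (rofs s - rp))))⁻¹ s := by
  have hs := hr1 s
  have hq : 0 < rofs s - rp := by linarith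
  have hp : 0 < rofs s - rm := by linarith
  refine HasDerivAt.of_local_left_inverse
    (f := fun r => r + (2 * κ)⁻¹ * Real.log ((r - rm) * (r - rp)))
    (tortoise_inverse_continuous hrmp hκ hr1 hr2).continuousAt ?_ (by positivity)
    (Eventually.of_forall hr2)
  have := (((hasDerivAt_id (rofs s)).sub_const rm).mul
    ((hasDerivAt_id (rofs s)).sub_const rp)).log (mul_pos hp hq).ne'
  exact ((hasDerivAt_id (rofs s)).add (this.const_mul (2 * κ)⁻¹)).congr_deriv (by simp)

theorem tortoise_inverse_tendsto (hrm : 0 ≤ rm) (hrmp : rm < rp) (hκ : 0 < κ)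
    (hr1 : ∀ s, rp < rofs s)
    (hr2 : ∀ s, rofs s + (2 * κ)⁻¹ * Real.log ((rofs s - rm) * (rofs s - rp)) = s) :
    Tendsto (fun s => rofs s - rp) atBot (nhds 0) := by
  have hlim : Tendsto (fun s : ℝ => Real.exp (2 * κ * s) / (rp - rm)) atBot (nhds 0) := by
    have : Tendsto (fun s : ℝ => Real.exp (2 * κ * s)) atBot (nhds 0) :=
      Real.tendsto_exp_atBot.comp (tendsto_id.const_mul_atBot (by positivity))
    simpa using this.div_const (rp - rm)
  refine squeeze_zero (fun s => by linarith [hr1 s]) (fun s => ?_) hlim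
  have hs := hr1 s
  have hq : 0 < rofs s - rp := by linarith
  have hp : 0 < rofs s - rm := by linarith
  have hlog : Real.log ((rofs s - rm) * (rofs s - rp)) = 2 * κ * (s - rofs s) := by
    have := hr2 s
    field_simp at this
    linarith
  have hexp : (rofs s - rm) * (rofs s - rp) ≤ Real.exp (2 * κ * s) := by
    rw [← Real.exp_log (mul_pos hp hq), hlog, Real.exp_le_exp]
    have : 0 ≤ 2 * κ * rofs s := mul_nonneg (by positivity) (by linarith)
    linarith
  rw [le_div_iff₀ (by linarith)]
  nlinarith

theorem tortoise_inverse_deriv_ge (hrm : 0 ≤ rm) (hrmp : rm < rp) (hκ : 0 < κ) {R r : ℝ}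
    (hr : rp < r) (hrR : r ≤ R) :
    (R + (2 * κ)⁻¹ * (2 * R / (rp - rm)))⁻¹ * (r - rp) ≤
      (1 + (2 * κ)⁻¹ * ((r - rp + (r - rm)) / ((r - rm) * (r - rp))))⁻¹ := by
  have hq : 0 < r - rp := by linarith
  have hp : 0 < r - rm := by linarith
  have hd : 0 < rp - rm := by linarith
  have hR : 0 < R := by linarith
  have hinv : ∀ A : ℝ, (A⁻¹ * (r - rp))⁻¹ = A / (r - rp) := fun A => by
    rw [mul_inv, inv_inv, div_eq_mul_inv]
  rw [le_inv_comm₀ (by positivity) (by positivity), hinv, le_div_iff₀ hq, add_mul, one_mul]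
  have e : (2 * κ)⁻¹ * ((r - rp + (r - rm)) / ((r - rm) * (r - rp))) * (r - rp)
    = (2 * κ)⁻¹ * ((r - rp + (r - rm)) / (r - rm)) := by field_simp
  rw [e]
  refine add_le_add (by linarith) ?_
  gcongr; linarith

end Tortoise

/-- The barrier part `V + ω²` of the potential is at most of size `L²` times the distance to the
horizon. -/
theorem abs_Vpot_add_sq_le {M m E rm rp R : ℝ} {rofs : ℝ → ℝ} {ω s : ℝ} {L : ℕ} (hM : 0 < M)
    (hsum : rm + rp = 2 * M) (hprod : rm * rp = E ^ 2) (hrm : 0 ≤ rm) (hrp : 0 < rp)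
    (hrM : rm ≤ M) (hL : 1 ≤ L) (hr : rp < rofs s) (hrR : rofs s ≤ R) :
    |Vpot M m E rofs ω L s + ω ^ 2| ≤
      ((1 + R / rp ^ 2 * (m ^ 2 + 2 / rp ^ 2 + 2 * M * R / rp ^ 4)) * L) ^ 2 * (rofs s - rp) := by
  set r := rofs s with hrdef
  have hr0 : 0 < r := by linarith
  have hR0 : 0 < R := by linarith
  have hL' : (1 : ℝ) ≤ L := by exact_mod_cast hL
  have hf : 1 - 2 * M / r + E ^ 2 / r ^ 2 = (r - rm) * (r - rp) / r ^ 2 := by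
    rw [← hsum, ← hprod]; field_simp; ring
  have hV : Vpot M m E rofs ω L s + ω ^ 2 = (r - rm) * (r - rp) / r ^ 2 *
      (m ^ 2 + ((L : ℝ) * ((L : ℝ) + 1)) / r ^ 2 + (2 * M * r - 2 * E ^ 2) / r ^ 4) := by
    rw [Vpot, ← hrdef, hf]; ring
  have hq : 0 < r - rp := by linarith
  have hp : 0 < r - rm := by linarith
  have hE : 0 ≤ 2 * M * r - 2 * E ^ 2 := by rw [← hprod]; nlinarith
  have hL2 : (1 : ℝ) ≤ (L : ℝ) ^ 2 := one_le_pow₀ hL'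
  set k := R / rp ^ 2 * (m ^ 2 + 2 / rp ^ 2 + 2 * M * R / rp ^ 4) with hk
  have hk0 : 0 ≤ k := by positivity
  have h1 : (r - rm) * (r - rp) / r ^ 2 ≤ R / rp ^ 2 * (r - rp) := by
    have : (r - rm) * (r - rp) / r ^ 2 ≤ R * (r - rp) / rp ^ 2 := by gcongr; linarith
    exact this.trans_eq (by ring)
  have h2 : m ^ 2 + ((L : ℝ) * ((L : ℝ) + 1)) / r ^ 2 + (2 * M * r - 2 * E ^ 2) / r ^ 4 ≤
      (m ^ 2 + 2 / rp ^ 2 + 2 * M * R / rp ^ 4) * L ^ 2 := by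
    have a1 : m ^ 2 ≤ m ^ 2 * L ^ 2 := le_mul_of_one_le_right (sq_nonneg _) hL2
    have a2 : ((L : ℝ) * ((L : ℝ) + 1)) / r ^ 2 ≤ 2 / rp ^ 2 * L ^ 2 := by
      have : (L : ℝ) * ((L : ℝ) + 1) ≤ 2 * L ^ 2 := by nlinarith
      calc ((L : ℝ) * ((L : ℝ) + 1)) / r ^ 2 ≤ 2 * L ^ 2 / rp ^ 2 := by gcongr
        _ = _ := by ring
    have a3 : (2 * M * r - 2 * E ^ 2) / r ^ 4 ≤ 2 * M * R / rp ^ 4 := by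
      gcongr; nlinarith [sq_nonneg E]
    have a4 : 2 * M * R / rp ^ 4 ≤ 2 * M * R / rp ^ 4 * L ^ 2 :=
      le_mul_of_one_le_right (by positivity) hL2
    linarith
  rw [hV, abs_of_nonneg (by positivity)]
  calc _ ≤ R / rp ^ 2 * (r - rp) * ((m ^ 2 + 2 / rp ^ 2 + 2 * M * R / rp ^ 4) * L ^ 2) := by gcongr
    _ = k * L ^ 2 * (r - rp) := by rw [hk]; ring
    _ ≤ (1 + k) ^ 2 * L ^ 2 * (r - rp) := by gcongr; nlinarith
    _ = _ := by ring

theorem inv_one_add_rpow_le {δ : ℝ} (hδ : δ ∈ Ioo (0 : ℝ) 1) (x : ℝ) :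
    (1 + |x| ^ (1 + δ))⁻¹ ≤ 4 * (1 + ‖x‖) ^ (-(1 + δ)) := by
  have hx := abs_nonneg x
  have hd : 0 ≤ 1 + δ := by linarith [hδ.1]
  rw [Real.norm_eq_abs, Real.rpow_neg (by positivity), ← div_eq_mul_inv,
    le_div_iff₀ (by positivity), inv_mul_le_iff₀ (by positivity)]
  have h2 : (2 : ℝ) ^ (1 + δ) ≤ 4 := by
    calc (2 : ℝ) ^ (1 + δ) ≤ 2 ^ (2 : ℝ) :=
          Real.rpow_le_rpow_of_exponent_le (by norm_num) (by linarith [hδ.2])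
      _ = 4 := by norm_num
  have hp : 0 ≤ |x| ^ (1 + δ) := by positivity
  rcases le_total |x| 1 with h | h
  · have : (1 + |x|) ^ (1 + δ) ≤ 2 ^ (1 + δ) := Real.rpow_le_rpow (by positivity) (by linarith) hd
    linarith
  · have : (1 + |x|) ^ (1 + δ) ≤ (2 * |x|) ^ (1 + δ) :=
      Real.rpow_le_rpow (by positivity) (by linarith) hd
    rw [Real.mul_rpow (by norm_num) hx] at this
    have := mul_le_mul_of_nonneg_right h2 hp
    linarith

theorem sq_mul_exp_sq_le {x : ℝ} (hx : 0 ≤ x) (y : ℝ) :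
    x ^ 2 * Real.exp y ^ 2 ≤ Real.exp (2 * x + 2 * y) := by
  have h1 : x ≤ Real.exp x := by linarith [Real.add_one_le_exp x]
  have h2 : Real.exp (2 * x + 2 * y) = Real.exp x ^ 2 * Real.exp y ^ 2 := by
    rw [← Real.exp_nat_mul, ← Real.exp_nat_mul, ← Real.exp_add]
    push_cast
    rfl
  rw [h2]
  exact mul_le_mul_of_nonneg_right (pow_le_pow_left₀ hx h1 2) (sq_nonneg _)

theorem weighted_sq_norm_le {a b : ℂ} {ω m r rp R X δ s : ℝ} (hω0 : 0 < ω) (hωm : ω < m)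
    (hδ : δ ∈ Ioo (0 : ℝ) 1) (hr : rp < r) (hrR : r ≤ R) (hX : ‖a‖ ^ 2 ≤ X) :
    r / (r - rp) * ‖b + Complex.I * ω * a‖ ^ 2 +
        (1 + |s| ^ (1 + δ))⁻¹ * (‖b‖ ^ 2 + ‖a‖ ^ 2) ≤
      (R + 2 * (R - rp)) * (‖b + Complex.I * ω * a‖ ^ 2 / (r - rp)) +
        (2 * m ^ 2 + 1) * X * (4 * (1 + ‖s‖) ^ (-(1 + δ))) := by
  have hq : 0 < r - rp := sub_pos.2 hr
  have hX0 : 0 ≤ X := (sq_nonneg _).trans hX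
  have h3 : ‖b‖ ^ 2 ≤ 2 * ‖b + Complex.I * ω * a‖ ^ 2 + 2 * m ^ 2 * ‖a‖ ^ 2 := by
    have e : ‖b‖ ≤ ‖b + Complex.I * ω * a‖ + m * ‖a‖ := by
      calc ‖b‖ = ‖(b + Complex.I * ω * a) - Complex.I * ω * a‖ := by rw [add_sub_cancel_right]
        _ ≤ ‖b + Complex.I * ω * a‖ + ‖Complex.I * ω * a‖ := norm_sub_le _ _
        _ ≤ ‖b + Complex.I * ω * a‖ + m * ‖a‖ := by
          rw [norm_mul, norm_mul, Complex.norm_I, one_mul, Complex.norm_real, Real.norm_eq_abs,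
            abs_of_pos hω0]
          gcongr
    have := pow_le_pow_left₀ (norm_nonneg _) e 2
    nlinarith [sq_nonneg (‖b + Complex.I * ω * a‖ - m * ‖a‖)]
  generalize ‖b + Complex.I * ω * a‖ = w at *
  have hw : 0 ≤ w ^ 2 / (r - rp) := by positivity
  have h1 : r / (r - rp) * w ^ 2 ≤ R * (w ^ 2 / (r - rp)) := by
    rw [div_mul_eq_mul_div, mul_div_assoc]
    exact mul_le_mul_of_nonneg_right hrR hw
  have h2 : w ^ 2 ≤ (R - rp) * (w ^ 2 / (r - rp)) := by
    calc w ^ 2 = (r - rp) * (w ^ 2 / (r - rp)) := by field_simp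
      _ ≤ (R - rp) * (w ^ 2 / (r - rp)) :=
        mul_le_mul_of_nonneg_right (sub_le_sub_right hrR rp) hw
  have hy0 : 0 ≤ (1 + |s| ^ (1 + δ))⁻¹ := by positivity
  have hy1 : (1 + |s| ^ (1 + δ))⁻¹ ≤ 1 := inv_le_one_of_one_le₀
    (le_add_of_nonneg_right (by positivity))
  have hy2 := inv_one_add_rpow_le hδ s
  generalize (1 + |s| ^ (1 + δ))⁻¹ = y at *
  have h4 : ‖b‖ ^ 2 + ‖a‖ ^ 2 ≤ 2 * w ^ 2 + (2 * m ^ 2 + 1) * X := by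
    linarith [mul_le_mul_of_nonneg_left hX (by positivity : 0 ≤ 2 * m ^ 2 + 1)]
  have h5 := mul_le_mul_of_nonneg_left h4 hy0
  have h6 : y * (2 * w ^ 2) ≤ 2 * w ^ 2 := mul_le_of_le_one_left (by positivity) hy1
  have h7 := mul_le_mul_of_nonneg_left hy2 (by positivity : 0 ≤ (2 * m ^ 2 + 1) * X)
  linarith

namespace WeaklyOutgoing

variable {ω : ℝ} {u : ℝ → ℂ}

theorem tendsto_zero_atTop (h : WeaklyOutgoing ω u) :
    Tendsto u atTop (nhds 0) ∧ Tendsto (deriv u) atTop (nhds 0) := by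
  obtain ⟨ε, hε, h⟩ := h.2
  have key : ∀ s : ℝ, 0 ≤ s → ‖u s‖ + ‖deriv u s‖ ≤
      Real.exp (ε * s) * (‖u s‖ + ‖deriv u s‖) := fun s hs =>
    le_mul_of_one_le_left (by positivity) (Real.one_le_exp (by positivity))
  constructor <;> refine squeeze_zero_norm' ?_ h <;>
    filter_upwards [Ici_mem_atTop 0] with s hs
  · exact (le_add_of_nonneg_right (norm_nonneg _)).trans (key s hs)
  · exact (le_add_of_nonneg_left (norm_nonneg _)).trans (key s hs)

theorem tendsto_norm_atBot (h : WeaklyOutgoing ω u) :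
    ∃ a : ℝ, Tendsto (fun s => ‖u s‖) atBot (nhds a) := by
  obtain ⟨⟨c, h1, -⟩, -⟩ := h
  have h1 := h1.norm
  rw [norm_zero] at h1
  refine ⟨‖c‖, tendsto_iff_norm_sub_tendsto_zero.2
    (squeeze_zero (fun _ => norm_nonneg _) (fun s => ?_) h1)⟩
  rw [Real.norm_eq_abs]
  have : ‖c‖ = ‖c * Complex.exp (-Complex.I * ω * s)‖ := by
    rw [norm_mul, Complex.norm_exp]; simp
  rw [this]
  exact abs_norm_sub_norm_le _ _

theorem tendsto_outgoing_atBot (h : WeaklyOutgoing ω u) :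
    Tendsto (fun s => deriv u s + Complex.I * ω * u s) atBot (nhds 0) := by
  obtain ⟨⟨c, h1, h2⟩, -⟩ := h
  have := h2.add (h1.const_mul (Complex.I * ω))
  rw [mul_zero, add_zero] at this
  refine this.congr fun s => ?_
  ring

end WeaklyOutgoing

set_option maxHeartbeats 1000000 in
/-- Exponential-loss estimate on a compact region for frequencies with
L^(-p) <= m^2 - w^2 <= C1 L^(-2), for sources supported in {r <= R}. -/
theorem statement6
    (M m E : ℝ) (hM : 0 < M) (hm : 0 < m) (hE : |E| < M)
    (rm rp κ : ℝ)
    (hrm : rm = M - Real.sqrt (M ^ 2 - E ^ 2))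
    (hrp : rp = M + Real.sqrt (M ^ 2 - E ^ 2))
    (hκ : κ = (M * rp - E ^ 2) / rp ^ 3)
    (rofs : ℝ → ℝ)
    (hr1 : ∀ s : ℝ, rp < rofs s)
    (hr2 : ∀ s : ℝ, rofs s + (2 * κ)⁻¹ * Real.log ((rofs s - rm) * (rofs s - rp)) = s) :
    ∀ R : ℝ, rp < R →
    ∃ D₀ : ℝ, 0 < D₀ ∧
    ∀ p : ℕ, 2 ≤ p → ∀ C₁ : ℝ, 0 < C₁ → ∀ δ : ℝ, δ ∈ Set.Ioo (0 : ℝ) 1 →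
    ∃ C : ℝ, 0 < C ∧ ∃ L₀ : ℕ, ∀ L : ℕ, L₀ ≤ L →
    ∀ ω : ℝ, 0 < ω → ω < m →
      ((L : ℝ) ^ p)⁻¹ ≤ m ^ 2 - ω ^ 2 → m ^ 2 - ω ^ 2 ≤ C₁ * ((L : ℝ) ^ 2)⁻¹ →
    ∀ H u : ℝ → ℂ, Continuous H → ContDiff ℝ 2 u →
    (∀ s : ℝ, deriv (deriv u) s - (Vpot M m E rofs ω L s : ℂ) * u s = H s) →
    WeaklyOutgoing ω u →
    (∀ s : ℝ, R < rofs s → H s = 0) →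
    (∫⁻ s in Set.Iic (R + (2 * κ)⁻¹ * Real.log ((R - rm) * (R - rp))),
        ENNReal.ofReal (rofs s / (rofs s - rp) * ‖deriv u s + Complex.I * (ω : ℂ) * u s‖ ^ 2
          + (1 + |s| ^ (1 + δ))⁻¹ * (‖deriv u s‖ ^ 2 + ‖u s‖ ^ 2)))
      ≤ ENNReal.ofReal (C * Real.exp (D₀ * (L : ℝ))) *
        ∫⁻ s in Set.Iic (R + (2 * κ)⁻¹ * Real.log ((R - rm) * (R - rp))),
          ENNReal.ofReal (rofs s / (rofs s - rp) * ‖H s‖ ^ 2) := by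
  intro R hR
  have hE2 : E ^ 2 < M ^ 2 := sq_lt_sq.2 (by rwa [abs_of_pos hM])
  have hsq : Real.sqrt (M ^ 2 - E ^ 2) ^ 2 = M ^ 2 - E ^ 2 := Real.sq_sqrt (by linarith)
  have hsq0 : 0 < Real.sqrt (M ^ 2 - E ^ 2) := Real.sqrt_pos.2 (by linarith)
  have hsum : rm + rp = 2 * M := by rw [hrm, hrp]; ring
  have hprod : rm * rp = E ^ 2 := by rw [hrm, hrp]; linarith
  have hrm0 : 0 ≤ rm := by
    rw [hrm, sub_nonneg]
    exact Real.sqrt_le_iff.2 ⟨hM.le, by linarith [sq_nonneg E]⟩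
  have hMp : M < rp := by linarith
  have hmM : rm < M := by linarith
  have hrmp : rm < rp := by linarith
  have hrp0 : 0 < rp := by linarith
  have hR0 : 0 < R := by linarith
  have hκ0 : 0 < κ := by
    rw [hκ]
    have : 0 < M * rp - E ^ 2 := by nlinarith
    positivity
  have hrc := tortoise_inverse_continuous hrmp hκ0 hr1 hr2
  have hrd := tortoise_inverse_hasDerivAt hrmp hκ0 hr1 hr2
  have hq0 := tortoise_inverse_tendsto hrm0 hrmp hκ0 hr1 hr2
  have hS := le_tortoise_iff hrmp hκ0 hr1 hr2 hR
  set S := R + (2 * κ)⁻¹ * Real.log ((R - rm) * (R - rp))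
  set c := (R + (2 * κ)⁻¹ * (2 * R / (rp - rm)))⁻¹ with hc
  have hc0 : 0 < c := by
    have : 0 < rp - rm := by linarith
    positivity
  set k := 1 + R / rp ^ 2 * (m ^ 2 + 2 / rp ^ 2 + 2 * M * R / rp ^ 4) with hk
  have hk1 : 1 ≤ k := le_add_of_nonneg_right (by positivity)
  have hk0 : 0 < k := by linarith
  set Q := R - rp with hQ
  have hQ0 : 0 < Q := by linarith
  set q : ℝ → ℝ := fun s => rofs s - rp with hqdef
  have hqpos : ∀ s, 0 < q s := fun s => sub_pos.2 (hr1 s)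
  have hqc : Continuous q := hrc.sub continuous_const
  have hrpos : ∀ s, 0 < rofs s := fun s => hrp0.trans (hr1 s)
  refine ⟨(2 + 8 / c * √Q) * k, by positivity, ?_⟩
  intro p _ C₁ hC₁ δ hδ
  have hδ1 : ∀ s : ℝ, 0 ≤ 4 * (1 + ‖s‖) ^ (-(1 + δ)) := fun s => by positivity
  have hδint : Integrable (fun s : ℝ => 4 * (1 + ‖s‖) ^ (-(1 + δ))) :=
    (integrable_one_add_norm (by simpa using hδ.1)).const_mul 4
  have hδc : Continuous (fun s : ℝ => 4 * (1 + ‖s‖) ^ (-(1 + δ))) :=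
    continuous_const.mul ((continuous_const.add continuous_norm).rpow_const
      fun s => Or.inl (add_pos_of_pos_of_nonneg one_pos (norm_nonneg s)).ne')
  set Iδ := ∫ s : ℝ, 4 * (1 + ‖s‖) ^ (-(1 + δ)) with hIδ
  have hIδ0 : 0 ≤ Iδ := integral_nonneg hδ1
  set K₁ := 8 / c + Q / ((m / 2) ^ 2 * c) with hK₁
  have hK₁0 : 0 < K₁ := by positivity
  set K₂ := (R + 2 * Q) * (2 / c) + (2 * m ^ 2 + 1) * Iδ with hK₂
  have hK₂0 : 0 < K₂ := by positivity
  refine ⟨K₂ * K₁ / rp, by positivity, max 1 ⌈2 * C₁ / m ^ 2⌉₊, ?_⟩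
  intro L hL ω hω0 hωm _ hω H u hH hu hode hout hsupp
  have hL1 : 1 ≤ L := (le_max_left _ _).trans hL
  have hL1' : (1 : ℝ) ≤ L := by exact_mod_cast hL1
  have hωhalf : m / 2 ≤ ω := by
    have h1 : 2 * C₁ / m ^ 2 ≤ L :=
      (Nat.le_ceil _).trans (by exact_mod_cast (le_max_right _ _).trans hL)
    have h2 : C₁ * ((L : ℝ) ^ 2)⁻¹ ≤ m ^ 2 / 2 := by
      rw [div_le_iff₀ (by positivity)] at h1
      rw [← div_eq_mul_inv, div_le_iff₀ (by positivity)]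
      nlinarith [mul_le_mul_of_nonneg_left hL1' (by positivity : 0 ≤ L * m ^ 2)]
    nlinarith
  rcases eq_or_ne (∫⁻ s in Iic S, ENNReal.ofReal (rofs s / (rofs s - rp) * ‖H s‖ ^ 2)) ⊤
    with htop | hfin
  · rw [htop, ENNReal.mul_top (by
      rw [Ne, ENNReal.ofReal_eq_zero, not_le]; positivity)]
    exact le_top
  set T := (∫⁻ s in Iic S, ENNReal.ofReal (rofs s / (rofs s - rp) * ‖H s‖ ^ 2)).toReal with hT
  have hsc : Continuous fun s => rofs s / (rofs s - rp) * ‖H s‖ ^ 2 :=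
    (hrc.div hqc fun s => (hqpos s).ne').mul (hH.norm.pow 2)
  have hs0 : ∀ s, 0 ≤ rofs s / (rofs s - rp) * ‖H s‖ ^ 2 := fun s =>
    mul_nonneg (div_nonneg (hrpos s).le (hqpos s).le) (sq_nonneg _)
  have hhc : Continuous fun s => ‖H s‖ ^ 2 / q s := (hH.norm.pow 2).div hqc fun s => (hqpos s).ne'
  have hv : ContDiff ℝ 1 (deriv u) := ((contDiff_succ_iff_deriv (n := 1)).1 hu).2.2
  have hud : ∀ s, HasDerivAt u (deriv u s) s := fun s =>
    (hu.differentiable (by norm_num) s).hasDerivAt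
  set w : ℝ → ℂ := fun s => deriv u s + Complex.I * ω * u s with hw
  have hwc : Continuous w := hv.continuous.add (continuous_const.mul hu.continuous)
  have hdc : Continuous fun s => ‖w s‖ ^ 2 / q s := (hwc.norm.pow 2).div hqc fun s => (hqpos s).ne'
  obtain ⟨a, ha⟩ := hout.tendsto_norm_atBot
  have hbound := outgoing_solution_bound (c := c) (Λ := k * L) (Q := Q) (μ := m / 2) (ω := ω)
    (S := S) (q := q) (W := fun s => Vpot M m E rofs ω L s + ω ^ 2) (J := T / rp)
    (h := fun t => ∫ s in S..t, ‖H s‖ ^ 2 / q s) (d := fun t => ∫ s in S..t, ‖w s‖ ^ 2 / q s)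
    hc0 (one_le_mul_of_one_le_of_one_le hk1 hL1') (by positivity) hωhalf
    (fun s _ => hqpos s) (fun s hs => sub_le_sub_right ((hS s).1 hs) rp)
    (fun s _ => (hrd s).sub_const rp)
    (fun s hs => tortoise_inverse_deriv_ge hrm0 hrmp hκ0 (hr1 s) ((hS s).1 hs)) hq0
    (fun s hs => abs_Vpot_add_sq_le hM hsum hprod hrm0 hrp0 hmM.le hL1 (hr1 s) ((hS s).1 hs))
    hud
    (fun s => by
      refine (hv.differentiable (by norm_num) s).hasDerivAt.congr_deriv ?_
      rw [← hode s]
      push_cast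
      ring)
    (fun s hs => hsupp s (lt_of_not_ge fun h => absurd ((hS s).2 h) (not_le.2 hs)))
    (fun s _ => hhc.hasDerivAt_intervalIntegral S s)
    (fun s₀ s h1 h2 => by
      rw [intervalIntegral.integral_interval_sub_left (hhc.intervalIntegrable _ _)
        (hhc.intervalIntegrable _ _), le_div_iff₀ hrp0, ← intervalIntegral.integral_mul_const]
      refine le_trans ?_ (intervalIntegral_le_toReal_lintegral_Iic hsc hs0 hfin h1 h2)
      refine intervalIntegral.integral_mono_on h1 ((hhc.mul continuous_const).intervalIntegrable _ _)
        (hsc.intervalIntegrable _ _) fun s _ => ?_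
      have := hqpos s
      calc ‖H s‖ ^ 2 / q s * rp ≤ ‖H s‖ ^ 2 / q s * rofs s := by gcongr; exact (hr1 s).le
        _ = _ := by ring)
    (fun s _ => hdc.hasDerivAt_intervalIntegral S s)
    hout.tendsto_zero_atTop.1 hout.tendsto_zero_atTop.2 ha hout.tendsto_outgoing_atBot
  set X := K₁ * (k * L) ^ 2 * Real.exp (4 * (k * L) / c * √Q) ^ 2 * (T / rp) with hX
  have hT0 : 0 ≤ T := ENNReal.toReal_nonneg
  have hX0 : 0 ≤ X := by positivity
  have huX : ∀ s ≤ S, ‖u s‖ ^ 2 ≤ X := fun s hs => by simpa using hbound s s le_rfl hs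
  have hdX : ∀ s₀ ≤ S, ∫ s in s₀..S, ‖w s‖ ^ 2 / q s ≤ 2 / c * X := by
    intro s₀ h
    have h1 := hbound s₀ S h le_rfl
    simp only [intervalIntegral.integral_same, zero_sub] at h1
    rw [← intervalIntegral.integral_symm] at h1
    have h2 : c / 2 * ∫ s in s₀..S, ‖w s‖ ^ 2 / q s ≤ X := by linarith [sq_nonneg ‖u S‖]
    calc ∫ s in s₀..S, ‖w s‖ ^ 2 / q s = 2 / c * (c / 2 * ∫ s in s₀..S, ‖w s‖ ^ 2 / q s) := by
          field_simp
      _ ≤ 2 / c * X := mul_le_mul_of_nonneg_left h2 (by positivity)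
  have hpt : ∀ s ∈ Iic S, rofs s / (rofs s - rp) * ‖w s‖ ^ 2 +
      (1 + |s| ^ (1 + δ))⁻¹ * (‖deriv u s‖ ^ 2 + ‖u s‖ ^ 2) ≤
      (R + 2 * Q) * (‖w s‖ ^ 2 / q s) +
        (2 * m ^ 2 + 1) * X * (4 * (1 + ‖s‖) ^ (-(1 + δ))) := by
    exact fun s hs => weighted_sq_norm_le hω0 hωm hδ (hr1 s) ((hS s).1 hs) (huX s hs)
  clear_value X K₁ K₂ k c Q T Iδ
  have hexp : (k * L) ^ 2 * Real.exp (4 * (k * L) / c * √Q) ^ 2 ≤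
      Real.exp ((2 + 8 / c * √Q) * k * L) := by
    refine (sq_mul_exp_sq_le (by positivity) _).trans_eq (congrArg Real.exp ?_)
    ring
  have hXle : K₂ * X ≤ K₂ * K₁ / rp * Real.exp ((2 + 8 / c * √Q) * k * L) * T := by
    rw [show K₂ * X = K₂ * K₁ / rp * ((k * L) ^ 2 * Real.exp (4 * (k * L) / c * √Q) ^ 2) * T by
      rw [hX]; ring]
    exact mul_le_mul_of_nonneg_right (mul_le_mul_of_nonneg_left hexp (by positivity)) hT0
  calc _ ≤ ∫⁻ s in Iic S, ENNReal.ofReal ((R + 2 * Q) * (‖w s‖ ^ 2 / q s) +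
        (2 * m ^ 2 + 1) * X * (4 * (1 + ‖s‖) ^ (-(1 + δ)))) :=
      setLIntegral_mono' measurableSet_Iic fun s hs => ENNReal.ofReal_le_ofReal (hpt s hs)
    _ ≤ ENNReal.ofReal (K₂ * X) := by
      have hg : Continuous fun s => (R + 2 * Q) * (‖w s‖ ^ 2 / q s) +
          (2 * m ^ 2 + 1) * X * (4 * (1 + ‖s‖) ^ (-(1 + δ))) :=
        (continuous_const.mul hdc).add (continuous_const.mul hδc)
      refine lintegral_Iic_le_of_intervalIntegral_le hg (fun s => ?_) fun s₀ h => ?_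
      · have := hqpos s
        have := hδ1 s
        positivity
      · rw [intervalIntegral.integral_add ((hdc.intervalIntegrable _ _).const_mul _)
          ((hδc.intervalIntegrable _ _).const_mul _),
          intervalIntegral.integral_const_mul, intervalIntegral.integral_const_mul]
        have h1 : ∫ s in s₀..S, 4 * (1 + ‖s‖) ^ (-(1 + δ)) ≤ Iδ := by
          rw [intervalIntegral.integral_of_le h]
          exact (setIntegral_le_integral hδint (Eventually.of_forall hδ1)).trans_eq hIδ.symm
        calc _ ≤ (R + 2 * Q) * (2 / c * X) + (2 * m ^ 2 + 1) * X * Iδ := by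
              gcongr
              exact hdX s₀ h
          _ = _ := by rw [hK₂]; ring
    _ ≤ ENNReal.ofReal (K₂ * K₁ / rp * Real.exp ((2 + 8 / c * √Q) * k * L) * T) :=
      ENNReal.ofReal_le_ofReal hXle
    _ = _ := by
      rw [ENNReal.ofReal_mul (by positivity), hT, ENNReal.ofReal_toReal hfin]
end

section
/- Assume the Reissner–Nordström radial setup stated in the context. Let p ≥ 2 be an integer, C₁ > 0, δ₁ ∈ (0, 1), δ̃ ∈ (0, 1), and S₀ > 0. There exists C > 0, depending only on δ₁, δ̃, S₀, p, C₁, M, 𝐞, m, such that for all sufficiently large integers L, all ω ∈ (0, m) with L^{−p} ≤ m² − ω² ≤ C₁·L^{−2}, and every weakly outgoing C² solution u of u'' − V(ω, L, ·)·u = H, one has ∫_{−∞}^{S₀} [ (r/(r − r₊))·|u' + iωu|² + (max(0, −s)^{1+δ₁} + 1)⁻¹·(|u'|² + |u|²) ] ds ≤ C·( e^{−(4−δ̃)·𝕃·log 𝕃}·∫_{0}^{∞} |u|² ds + 𝕃²·∫_{−∞}^{∞} (r/(r − r₊))·|H|² ds ). -/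
open MeasureTheory Filter Set

/-- The tortoise-type coordinate as a function of the area radius. -/
noncomputable def tortoise (rm rp b r : ℝ) : ℝ :=
  r + b * Real.log ((r - rm) * (r - rp))

theorem hasDerivAt_tortoise {rm rp b r : ℝ} (hmp : rm < rp) (hr : rp < r) :
    HasDerivAt (tortoise rm rp b) (1 + b * (1 / (r - rm) + 1 / (r - rp))) r := by
  have h1 : r - rm ≠ 0 := by linarith
  have h2 : r - rp ≠ 0 := by linarith
  have hp : HasDerivAt (fun r : ℝ => (r - rm) * (r - rp)) (1 * (r - rp) + (r - rm) * 1) r :=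
    ((hasDerivAt_id r).sub_const rm).mul ((hasDerivAt_id r).sub_const rp)
  have h := (hasDerivAt_id r).add ((hp.log (mul_ne_zero h1 h2)).const_mul b)
  refine h.congr_deriv ?_
  field_simp

theorem sub_le_tortoise_sub {rm rp b r₁ r₂ : ℝ} (hmp : rm < rp) (hb : 0 < b)
    (h₁ : rp < r₁) (h₁₂ : r₁ ≤ r₂) :
    r₂ - r₁ ≤ tortoise rm rp b r₂ - tortoise rm rp b r₁ := by
  have h : Real.log ((r₁ - rm) * (r₁ - rp)) ≤ Real.log ((r₂ - rm) * (r₂ - rp)) := by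
    apply Real.log_le_log
    · exact mul_pos (by linarith) (by linarith)
    · exact mul_le_mul (by linarith) (by linarith) (by linarith) (by linarith)
  have := mul_le_mul_of_nonneg_left h hb.le
  unfold tortoise
  linarith

/-- The data of an inverse tortoise map used in the estimates: `r` is a strictly increasing
bijection onto `(rp, ∞)` with derivative `g`, comparable to the identity near infinity. -/
structure InverseTortoise (rp b : ℝ) (r g : ℝ → ℝ) : Prop where
  b_pos : 0 < b
  lt : ∀ s, rp < r s
  hasDeriv : ∀ s, HasDerivAt r (g s) s
  g_pos : ∀ s, 0 < g s
  g_le_one : ∀ s, g s ≤ 1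
  sub_le : ∀ s, r s - rp ≤ (r s - rp + 2 * b) * g s
  continuous_g : Continuous g
  strictMono : StrictMono r
  surj : ∀ ρ, rp < ρ → ∃ s, r s = ρ
  large : ∃ S, ∀ s, S ≤ s → s / 2 ≤ r s ∧ r s ≤ s

theorem inverseTortoise_of_rightInverse {rm rp b : ℝ} {r : ℝ → ℝ} (hm0 : 0 ≤ rm) (hmp : rm < rp)
    (hb : 0 < b) (hr1 : ∀ s, rp < r s) (hr2 : ∀ s, tortoise rm rp b (r s) = s) :
    ∃ g, InverseTortoise rp b r g := by
  have hmono : StrictMono r := by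
    intro s t hst
    by_contra! h
    have := sub_le_tortoise_sub hmp hb (hr1 t) h
    rw [hr2, hr2] at this
    linarith
  have hlip : ∀ s t, s ≤ t → r t - r s ≤ t - s := by
    intro s t hst
    have := sub_le_tortoise_sub hmp hb (hr1 s) (hmono.monotone hst)
    rwa [hr2, hr2] at this
  have hcont : Continuous r := by
    have : LipschitzWith 1 r := by
      apply LipschitzWith.of_le_add
      intro s t
      rcases le_total s t with h | h
      · have := hmono.monotone h
        have := dist_nonneg (x := s) (y := t)
        linarith
      · have := hlip t s h
        rw [Real.dist_eq, abs_of_nonneg (by linarith)]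
        linarith
    exact this.continuous
  have hposm : ∀ s, 0 < r s - rm := fun s => by linarith [hr1 s]
  have hposp : ∀ s, 0 < r s - rp := fun s => by linarith [hr1 s]
  have hdpos : ∀ s, 0 < b * (1 / (r s - rm) + 1 / (r s - rp)) := fun s =>
    mul_pos hb (add_pos (one_div_pos.2 (hposm s)) (one_div_pos.2 (hposp s)))
  refine ⟨fun s => (1 + b * (1 / (r s - rm) + 1 / (r s - rp)))⁻¹, hb, hr1, ?_, ?_, ?_, ?_, ?_,
    hmono, ?_, ?_⟩
  · intro s
    exact HasDerivAt.of_local_left_inverse hcont.continuousAt (hasDerivAt_tortoise hmp (hr1 s))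
      (by linarith [hdpos s]) (Eventually.of_forall hr2)
  · intro s
    have := hdpos s
    positivity
  · intro s
    exact inv_le_one_of_one_le₀ (by linarith [hdpos s])
  · intro s
    have hx := hposp s
    have h1 := hdpos s
    have h2 : 1 / (r s - rm) ≤ 1 / (r s - rp) := one_div_le_one_div_of_le hx (by linarith)
    rw [← div_eq_mul_inv, le_div_iff₀ (by linarith)]
    have h3 : (r s - rp) * (1 / (r s - rp)) = 1 := mul_one_div_cancel hx.ne'
    have h4 := mul_le_mul_of_nonneg_left h2 (mul_pos hx hb).le
    nlinarith
  · refine Continuous.inv₀ ?_ fun s => by linarith [hdpos s]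
    refine continuous_const.add (continuous_const.mul (Continuous.add ?_ ?_))
    · exact continuous_const.div (hcont.sub continuous_const) fun s => (hposm s).ne'
    · exact continuous_const.div (hcont.sub continuous_const) fun s => (hposp s).ne'
  · intro ρ hρ
    refine ⟨tortoise rm rp b ρ, ?_⟩
    have h2 := hr2 (tortoise rm rp b ρ)
    rcases le_total (r (tortoise rm rp b ρ)) ρ with h | h
    · have := sub_le_tortoise_sub hmp hb (hr1 _) h
      linarith
    · have := sub_le_tortoise_sub hmp hb hρ h
      linarith
  · have hlog : ∀ᶠ x : ℝ in atTop, Real.log x ≤ (2 * b)⁻¹ * x := by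
      have := Real.isLittleO_log_id_atTop.bound (c := (2 * b)⁻¹) (by positivity)
      filter_upwards [this, eventually_ge_atTop 1] with x hx h1
      simp only [id, Real.norm_eq_abs] at hx
      rw [abs_of_nonneg (show (0 : ℝ) ≤ x by linarith)] at hx
      exact (le_abs_self _).trans hx
    obtain ⟨X, hX⟩ := eventually_atTop.1 hlog
    set Y := max X (rp + 1) with hY
    have hYp : rp + 1 ≤ Y := le_max_right _ _
    refine ⟨tortoise rm rp b Y, fun s hs => ?_⟩
    have hrY : Y ≤ r s := by
      by_contra! h
      have := sub_le_tortoise_sub hmp hb (hr1 s) h.le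
      rw [hr2] at this
      linarith
    have hxp : 1 ≤ r s - rp := by linarith
    have hxm : 1 ≤ r s - rm := by linarith
    have e : r s + b * Real.log ((r s - rm) * (r s - rp)) = s := hr2 s
    have hl0 : 0 ≤ Real.log ((r s - rm) * (r s - rp)) :=
      Real.log_nonneg (one_le_mul_of_one_le_of_one_le hxm hxp)
    have hl1 : Real.log ((r s - rm) * (r s - rp)) ≤ 2 * Real.log (r s) := by
      rw [← Real.log_rpow (by linarith)]
      apply Real.log_le_log (by positivity)
      norm_num
      nlinarith
    have hl2 := hX (r s) ((le_max_left _ _).trans hrY)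
    have hl3 : b * Real.log ((r s - rm) * (r s - rp)) ≤ r s := by
      calc _ ≤ b * (2 * ((2 * b)⁻¹ * r s)) := by gcongr; linarith
        _ = r s := by field_simp
    have := mul_nonneg hb.le hl0
    constructor <;> linarith

/-- The potential, without the frequency term, as a function of the area radius. -/
noncomputable def radialF (M m E Λ r : ℝ) : ℝ :=
  (1 - 2 * M / r + E ^ 2 / r ^ 2) * (m ^ 2 + Λ / r ^ 2 + (2 * M * r - 2 * E ^ 2) / r ^ 4)

/-- The derivative of `radialF` in the area radius. -/
noncomputable def radialFDeriv (M m E Λ r : ℝ) : ℝ :=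
  (2 * M / r ^ 2 - 2 * E ^ 2 / r ^ 3) * (m ^ 2 + Λ / r ^ 2 + (2 * M * r - 2 * E ^ 2) / r ^ 4) +
    (1 - 2 * M / r + E ^ 2 / r ^ 2) * (-2 * Λ / r ^ 3 + (8 * E ^ 2 - 6 * M * r) / r ^ 5)

theorem hasDerivAt_radialF (M m E Λ : ℝ) {r : ℝ} (hr : 0 < r) :
    HasDerivAt (radialF M m E Λ) (radialFDeriv M m E Λ r) r := by
  have hr0 := hr.ne'
  have hid := hasDerivAt_id r
  have hpow : ∀ n : ℕ, HasDerivAt (fun r : ℝ => r ^ n) (n * r ^ (n - 1)) r :=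
    fun n => hasDerivAt_pow n r
  have h1 : HasDerivAt (fun r : ℝ => 1 - 2 * M / r + E ^ 2 / r ^ 2)
      (2 * M / r ^ 2 - 2 * E ^ 2 / r ^ 3) r := by
    refine ((((hasDerivAt_const r (2 * M)).div hid hr0).const_sub 1).add
      ((hasDerivAt_const r (E ^ 2)).div (hpow 2) (by positivity))).congr_deriv ?_
    simp only [id]
    field_simp
    push_cast
    ring
  have h2 : HasDerivAt (fun r : ℝ => m ^ 2 + Λ / r ^ 2 + (2 * M * r - 2 * E ^ 2) / r ^ 4)
      (-2 * Λ / r ^ 3 + (8 * E ^ 2 - 6 * M * r) / r ^ 5) r := by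
    refine ((((hasDerivAt_const r Λ).div (hpow 2) (by positivity)).const_add (m ^ 2)).add
      (((hid.const_mul (2 * M)).sub_const (2 * E ^ 2)).div (hpow 4)
        (by positivity))).congr_deriv ?_
    simp only [id]
    field_simp
    push_cast
    ring
  exact h1.mul h2

theorem blackening_eq {M E rm rp r : ℝ} (hsum : rm + rp = 2 * M) (hprod : rm * rp = E ^ 2)
    (hr : 0 < r) : 1 - 2 * M / r + E ^ 2 / r ^ 2 = (r - rm) * (r - rp) / r ^ 2 := by
  rw [← hsum, ← hprod]
  field_simp
  ring

theorem radialF_nonneg_le {M m E rm rp : ℝ} (hM : 0 < M) (hm0 : 0 ≤ rm) (hmp : rm < rp)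
    (hsum : rm + rp = 2 * M) (hprod : rm * rp = E ^ 2) (hE : E ^ 2 < M * rp) :
    ∃ C, 0 < C ∧ ∀ Λ, 1 ≤ Λ → ∀ r, rp < r →
      0 ≤ radialF M m E Λ r ∧ radialF M m E Λ r ≤ C * Λ * (r - rp) := by
  have hp : 0 < rp := by linarith
  refine ⟨1 / rp * (m ^ 2 + 1 / rp ^ 2 + 2 * M / rp ^ 3), by positivity, fun Λ hΛ r hr => ?_⟩
  have hr0 : 0 < r := hp.trans hr
  have hMr : E ^ 2 < M * r := hE.trans (by gcongr)
  have hX0 : 0 ≤ (2 * M * r - 2 * E ^ 2) / r ^ 4 := by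
    apply div_nonneg <;> [linarith; positivity]
  have hX1 : (2 * M * r - 2 * E ^ 2) / r ^ 4 ≤ 2 * M / rp ^ 3 := by
    calc (2 * M * r - 2 * E ^ 2) / r ^ 4 ≤ 2 * M * r / r ^ 4 := by
          gcongr; nlinarith [sq_nonneg E]
      _ = 2 * M / r ^ 3 := by field_simp
      _ ≤ _ := by gcongr
  have hL0 : 0 ≤ Λ / r ^ 2 := by positivity
  have hL1 : Λ / r ^ 2 ≤ Λ * (1 / rp ^ 2) := by
    rw [mul_one_div]; gcongr
  have hf0 : 0 ≤ (r - rm) * (r - rp) / r ^ 2 := by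
    apply div_nonneg (mul_nonneg _ _) <;> [skip; linarith; linarith]
    positivity
  have hf1 : (r - rm) * (r - rp) / r ^ 2 ≤ 1 / rp * (r - rp) := by
    rw [div_le_iff₀ (by positivity)]
    have h1 : (r - rm) * (r - rp) ≤ r * (r - rp) := by
      gcongr
      linarith
    have h2 : 1 ≤ 1 / rp * r := by
      rw [one_div_mul_eq_div, le_div_iff₀ hp]; linarith
    nlinarith [mul_nonneg hr0.le (sub_nonneg.2 hr.le)]
  unfold radialF
  rw [blackening_eq hsum hprod hr0]
  constructor
  · positivity
  · have hG : m ^ 2 + Λ / r ^ 2 + (2 * M * r - 2 * E ^ 2) / r ^ 4 ≤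
        Λ * (m ^ 2 + 1 / rp ^ 2 + 2 * M / rp ^ 3) := by
      have h1 : m ^ 2 ≤ Λ * m ^ 2 := le_mul_of_one_le_left (sq_nonneg m) hΛ
      have h2 : 2 * M / rp ^ 3 ≤ Λ * (2 * M / rp ^ 3) :=
        le_mul_of_one_le_left (by positivity) hΛ
      linarith
    calc _ ≤ 1 / rp * (r - rp) * (Λ * (m ^ 2 + 1 / rp ^ 2 + 2 * M / rp ^ 3)) := by
          gcongr
      _ = _ := by ring

theorem exists_le_radialFDeriv {M m E rm rp : ℝ} (hM : 0 < M) (hmp : rm < rp)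
    (hsum : rm + rp = 2 * M) (hprod : rm * rp = E ^ 2) (hE : E ^ 2 < M * rp) :
    ∃ ρ c, rp < ρ ∧ 0 < c ∧ ∀ Λ, 1 ≤ Λ → ∀ r, rp < r → r ≤ ρ →
      c * Λ ≤ radialFDeriv M m E Λ r := by
  have hp : 0 < rp := by linarith
  set q : ℝ → ℝ := fun r => (2 * M / r ^ 2 - 2 * E ^ 2 / r ^ 3) / r ^ 2 -
    (r - rm) * (r - rp) / r ^ 2 * (2 / r ^ 3 + 6 * M / r ^ 4) with hq
  have hqc : ContinuousAt q rp := by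
    have := hp.ne'
    fun_prop (disch := positivity)
  have hq0 : 0 < q rp := by
    have : q rp = 2 * (M * rp - E ^ 2) / rp ^ 5 := by
      simp only [hq]
      field_simp
      ring
    rw [this]
    apply div_pos <;> [linarith; positivity]
  have hev : ∀ᶠ r in nhds rp, q rp / 2 < q r := hqc.eventually_const_lt (by linarith)
  obtain ⟨ε, hε, hball⟩ := Metric.eventually_nhds_iff.1 hev
  refine ⟨rp + ε / 2, q rp / 2, by linarith, by linarith, fun Λ hΛ r hr hr' => ?_⟩
  have hqr : q rp / 2 < q r := hball (by rw [Real.dist_eq, abs_of_pos] <;> linarith)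
  have hr0 : 0 < r := hp.trans hr
  have hMr : E ^ 2 < M * r := hE.trans (by gcongr)
  have hX0 : 0 ≤ (2 * M * r - 2 * E ^ 2) / r ^ 4 := by
    apply div_nonneg <;> [linarith; positivity]
  have hf0 : 0 ≤ (r - rm) * (r - rp) / r ^ 2 := by
    apply div_nonneg (mul_nonneg _ _) <;> [skip; linarith; linarith]
    positivity
  have hfr : 0 ≤ 2 * M / r ^ 2 - 2 * E ^ 2 / r ^ 3 := by
    have : 2 * M / r ^ 2 - 2 * E ^ 2 / r ^ 3 = 2 * (M * r - E ^ 2) / r ^ 3 := by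
      field_simp
    rw [this]
    apply div_nonneg <;> [linarith; positivity]
  have h1 : (2 * M / r ^ 2 - 2 * E ^ 2 / r ^ 3) * (Λ / r ^ 2) ≤
      (2 * M / r ^ 2 - 2 * E ^ 2 / r ^ 3) *
        (m ^ 2 + Λ / r ^ 2 + (2 * M * r - 2 * E ^ 2) / r ^ 4) := by
    gcongr
    nlinarith [sq_nonneg m]
  have h2 : (r - rm) * (r - rp) / r ^ 2 * (-Λ * (2 / r ^ 3 + 6 * M / r ^ 4)) ≤
      (r - rm) * (r - rp) / r ^ 2 * (-2 * Λ / r ^ 3 + (8 * E ^ 2 - 6 * M * r) / r ^ 5) := by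
    apply mul_le_mul_of_nonneg_left _ hf0
    have e1 : 6 * M / r ^ 4 ≤ Λ * (6 * M / r ^ 4) :=
      le_mul_of_one_le_left (by positivity) hΛ
    have e2 : (8 * E ^ 2 - 6 * M * r) / r ^ 5 = 8 * E ^ 2 / r ^ 5 - 6 * M / r ^ 4 := by
      field_simp
    have e3 : 0 ≤ 8 * E ^ 2 / r ^ 5 := by positivity
    have e4 : -2 * Λ / r ^ 3 = -Λ * (2 / r ^ 3) := by ring
    rw [e2, e4]
    linarith
  unfold radialFDeriv
  rw [blackening_eq hsum hprod hr0]
  calc q rp / 2 * Λ ≤ q r * Λ := by gcongr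
    _ = (2 * M / r ^ 2 - 2 * E ^ 2 / r ^ 3) * (Λ / r ^ 2) +
        (r - rm) * (r - rp) / r ^ 2 * (-Λ * (2 / r ^ 3 + 6 * M / r ^ 4)) := by
      simp only [hq]; ring
    _ ≤ _ := add_le_add h1 h2

theorem le_radialF_sub_sq {M m E rm rp Λ ω r : ℝ}
    (hmp : rm < rp) (hsum : rm + rp = 2 * M) (hprod : rm * rp = E ^ 2) (hE : E ^ 2 < M * rp)
    (hM : 0 < M) (hω : 0 < ω) (hωm : ω < m) (hr : rp < r) :
    (r - rm) * (r - rp) / r ^ 2 * (Λ / r ^ 2) - 2 * M * m ^ 2 / r ≤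
      radialF M m E Λ r - ω ^ 2 := by
  have hr0 : 0 < r := by linarith
  have hMr : E ^ 2 < M * r := hE.trans (by gcongr)
  have hX0 : 0 ≤ (2 * M * r - 2 * E ^ 2) / r ^ 4 := by
    apply div_nonneg <;> [linarith; positivity]
  have hf0 : 0 ≤ (r - rm) * (r - rp) / r ^ 2 := by
    apply div_nonneg (mul_nonneg _ _) <;> [skip; linarith; linarith]
    positivity
  have h1 : ω ^ 2 ≤ m ^ 2 := by gcongr
  have h2 : (1 - 2 * M / r) * m ^ 2 ≤ (r - rm) * (r - rp) / r ^ 2 * m ^ 2 := by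
    rw [← blackening_eq hsum hprod hr0]
    gcongr
    have : 0 ≤ E ^ 2 / r ^ 2 := by positivity
    linarith
  have h3 := mul_nonneg hf0 hX0
  have h4 : 2 * M * m ^ 2 / r = 2 * M / r * m ^ 2 := by ring
  unfold radialF
  rw [blackening_eq hsum hprod hr0, h4]
  nlinarith

theorem exists_le_radialF_sub_sq_of_mem_Icc {M m E rm rp : ℝ}
    (hmp : rm < rp) (hsum : rm + rp = 2 * M) (hprod : rm * rp = E ^ 2) (hE : E ^ 2 < M * rp)
    (hM : 0 < M) {ρ R : ℝ} (hρ : rp < ρ) (hR : ρ ≤ R) :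
    ∃ c Λ₀, 0 < c ∧ ∀ Λ, Λ₀ ≤ Λ → ∀ ω, 0 < ω → ω < m → ∀ r, ρ ≤ r → r ≤ R →
      c * Λ ≤ radialF M m E Λ r - ω ^ 2 := by
  have hρ0 : 0 < ρ := by linarith
  have hR0 : 0 < R := by linarith
  set c := (ρ - rm) * (ρ - rp) / R ^ 2 / R ^ 2 with hc
  have hc0 : 0 < c := by
    have h1 : 0 < ρ - rm := by linarith
    have h2 : 0 < ρ - rp := by linarith
    positivity
  refine ⟨c / 2, max 0 (2 / c * (2 * M * m ^ 2 / ρ)), by positivity,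
    fun Λ hΛ ω hω hωm r hr hr' => ?_⟩
  have hΛ0 : 0 ≤ Λ := (le_max_left _ _).trans hΛ
  have hΛ1 := (le_max_right _ _).trans hΛ
  have hr0 : 0 < r := hρ0.trans_le hr
  have h := le_radialF_sub_sq (Λ := Λ) hmp hsum hprod hE hM hω hωm (hρ.trans_le hr)
  have h1 : c * Λ ≤ (r - rm) * (r - rp) / r ^ 2 * (Λ / r ^ 2) := by
    calc c * Λ = (ρ - rm) * (ρ - rp) / R ^ 2 * (Λ / R ^ 2) := by rw [hc]; ring
      _ ≤ _ := by
        have : 0 ≤ ρ - rp := by linarith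
        have : 0 ≤ r - rm := by linarith
        have : 0 ≤ r - rp := by linarith
        gcongr
  have h2 : 2 * M * m ^ 2 / r ≤ 2 * M * m ^ 2 / ρ := by gcongr
  have h3 : 2 * M * m ^ 2 / ρ ≤ c / 2 * Λ := by
    calc 2 * M * m ^ 2 / ρ = c / 2 * (2 / c * (2 * M * m ^ 2 / ρ)) := by field_simp
      _ ≤ _ := by gcongr
  linarith

theorem exists_le_radialF_sub_sq_far {M m E rm rp : ℝ}
    (hmp : rm < rp) (hsum : rm + rp = 2 * M) (hprod : rm * rp = E ^ 2) (hE : E ^ 2 < M * rp)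
    (hM : 0 < M) (hm : 0 < m) {η : ℝ} (hη : 0 < η) :
    ∃ R a, rp < R ∧ 0 < a ∧ ∀ Λ, 0 ≤ Λ → ∀ ω, 0 < ω → ω < m → ∀ r, R ≤ r → r ≤ a * Λ →
      (1 - η) * (Λ / r ^ 2) ≤ radialF M m E Λ r - ω ^ 2 := by
  refine ⟨max (rp + 1) (4 * M / η), η / (4 * M * m ^ 2),
    by linarith [le_max_left (rp + 1) (4 * M / η)], by positivity,
    fun Λ hΛ ω hω hωm r hr hra => ?_⟩
  have hr1 : rp + 1 ≤ r := (le_max_left _ _).trans hr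
  have hr2 : 4 * M / η ≤ r := (le_max_right _ _).trans hr
  have hr0 : 0 < r := by linarith
  have h := le_radialF_sub_sq (Λ := Λ) hmp hsum hprod hE hM hω hωm (by linarith : rp < r)
  rw [← blackening_eq hsum hprod hr0] at h
  have h1 : 2 * M / r ≤ η / 2 := by
    rw [div_le_iff₀ hη] at hr2
    rw [div_le_iff₀ hr0]
    linarith
  have h2 : 2 * M * m ^ 2 / r ≤ η / 2 * (Λ / r ^ 2) := by
    rw [div_mul_eq_mul_div, le_div_iff₀ (by positivity)] at hra
    rw [mul_div, div_le_div_iff₀ hr0 (by positivity)]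
    nlinarith
  have h3 : 0 ≤ E ^ 2 / r ^ 2 := by positivity
  have h4 : 0 ≤ Λ / r ^ 2 := by positivity
  nlinarith

theorem sub_le_integral_of_hasDerivAt_le {Φ Φ' φ : ℝ → ℝ} {a b : ℝ} (hab : a ≤ b)
    (hΦ : ∀ s, HasDerivAt Φ (Φ' s) s) (hφ : Continuous φ) (h : ∀ s ∈ Icc a b, Φ' s ≤ φ s) :
    Φ b - Φ a ≤ ∫ s in a..b, φ s :=
  intervalIntegral.sub_le_integral_of_hasDeriv_right_of_le hab
    (fun s _ => (hΦ s).continuousAt.continuousWithinAt) (fun s _ => (hΦ s).hasDerivWithinAt)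
    hφ.integrableOn_Icc fun s hs => h s (Ioo_subset_Icc_self hs)

theorem integral_le_sub_of_le_hasDerivAt {Φ Φ' φ : ℝ → ℝ} {a b : ℝ} (hab : a ≤ b)
    (hΦ : ∀ s, HasDerivAt Φ (Φ' s) s) (hφ : Continuous φ) (h : ∀ s ∈ Icc a b, φ s ≤ Φ' s) :
    ∫ s in a..b, φ s ≤ Φ b - Φ a :=
  intervalIntegral.integral_le_sub_of_hasDeriv_right_of_le hab
    (fun s _ => (hΦ s).continuousAt.continuousWithinAt) (fun s _ => (hΦ s).hasDerivWithinAt)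
    hφ.integrableOn_Icc fun s hs => h s (Ioo_subset_Icc_self hs)

theorem two_mul_inner_le {x y : ℂ} {t : ℝ} (ht : 0 < t) :
    2 * inner ℝ x y ≤ t * ‖x‖ ^ 2 + t⁻¹ * ‖y‖ ^ 2 := by
  have h1 := real_inner_le_norm x y
  have h2 : 2 * (‖x‖ * ‖y‖) ≤ t * ‖x‖ ^ 2 + t⁻¹ * ‖y‖ ^ 2 := by
    have h3 : 0 ≤ t⁻¹ * (t * ‖x‖ - ‖y‖) ^ 2 := by positivity
    have h4 : t⁻¹ * (t * ‖x‖ - ‖y‖) ^ 2 =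
        t * ‖x‖ ^ 2 + t⁻¹ * ‖y‖ ^ 2 - 2 * (‖x‖ * ‖y‖) := by
      field_simp; ring
    linarith
  linarith

theorem abs_two_mul_inner_le {x y : ℂ} {t : ℝ} (ht : 0 < t) :
    |2 * inner ℝ x y| ≤ t * ‖x‖ ^ 2 + t⁻¹ * ‖y‖ ^ 2 := by
  rw [abs_le]
  constructor
  · have := two_mul_inner_le (x := x) (y := -y) ht
    rw [inner_neg_right, norm_neg] at this
    linarith
  · exact two_mul_inner_le ht

/-- A solution `u` of `u'' = (F - ω²) u + H` with derivative `v`, together with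
`w = u' + iωu`. -/
structure RadialSolution (ω : ℝ) (F : ℝ → ℝ) (H u v w : ℝ → ℂ) : Prop where
  continuous_H : Continuous H
  hasDeriv_u : ∀ s, HasDerivAt u (v s) s
  hasDeriv_v : ∀ s, HasDerivAt v (((F s - ω ^ 2 : ℝ) : ℂ) * u s + H s) s
  w_eq : ∀ s, w s = v s + Complex.I * ω * u s

namespace RadialSolution

variable {ω : ℝ} {F : ℝ → ℝ} {H u v w : ℝ → ℂ}

theorem continuous_u (h : RadialSolution ω F H u v w) : Continuous u :=
  continuous_iff_continuousAt.2 fun s => (h.hasDeriv_u s).continuousAt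

theorem continuous_v (h : RadialSolution ω F H u v w) : Continuous v :=
  continuous_iff_continuousAt.2 fun s => (h.hasDeriv_v s).continuousAt

theorem continuous_w (h : RadialSolution ω F H u v w) : Continuous w := by
  have := h.continuous_u
  have := h.continuous_v
  rw [funext h.w_eq]
  fun_prop

theorem hasDerivAt_norm_sq_u (h : RadialSolution ω F H u v w) (s : ℝ) :
    HasDerivAt (fun s => ‖u s‖ ^ 2) (2 * inner ℝ (u s) (w s)) s := by
  refine (h.hasDeriv_u s).norm_sq.congr_deriv ?_
  rw [h.w_eq]
  simp only [Complex.inner, Complex.add_re, Complex.mul_re, Complex.mul_im, Complex.conj_re,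
    Complex.conj_im, Complex.I_re, Complex.I_im, Complex.ofReal_re, Complex.ofReal_im,
    Complex.add_im]
  ring

theorem hasDerivAt_w (h : RadialSolution ω F H u v w) (s : ℝ) :
    HasDerivAt w (Complex.I * ω * w s + (F s : ℂ) * u s + H s) s := by
  rw [funext h.w_eq]
  refine ((h.hasDeriv_v s).add ((h.hasDeriv_u s).const_mul (Complex.I * ω))).congr_deriv ?_
  push_cast
  linear_combination (-(ω : ℂ) ^ 2 * u s) * Complex.I_sq

theorem hasDerivAt_norm_sq_w (h : RadialSolution ω F H u v w) (s : ℝ) :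
    HasDerivAt (fun s => ‖w s‖ ^ 2)
      (2 * F s * inner ℝ (u s) (w s) + 2 * inner ℝ (w s) (H s)) s := by
  refine (h.hasDerivAt_w s).norm_sq.congr_deriv ?_
  simp only [Complex.inner, Complex.add_re, Complex.mul_re, Complex.mul_im, Complex.conj_re,
    Complex.conj_im, Complex.I_re, Complex.I_im, Complex.ofReal_re, Complex.ofReal_im,
    Complex.add_im]
  ring

theorem hasDerivAt_inner (h : RadialSolution ω F H u v w) (s : ℝ) :
    HasDerivAt (fun s => inner ℝ (u s) (v s))
      (‖v s‖ ^ 2 + (F s - ω ^ 2) * ‖u s‖ ^ 2 + inner ℝ (u s) (H s)) s := by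
  refine ((h.hasDeriv_u s).inner ℝ (h.hasDeriv_v s)).congr_deriv ?_
  rw [inner_add_right, ← Complex.real_smul, inner_smul_right, real_inner_self_eq_norm_sq,
    real_inner_self_eq_norm_sq]
  ring

variable {rp b : ℝ} {r g q : ℝ → ℝ}

/-- The multiplier estimate near the horizon for the current `|w|² - F|u|²`. -/
theorem multiplier_estimate (h : RadialSolution ω F H u v w) (hr : InverseTortoise rp b r g)
    {Fr : ℝ → ℝ} (hF : ∀ s, HasDerivAt F (Fr s * g s) s) (hqc : Continuous q) {Cq : ℝ}
    (hq : ∀ s, (g s)⁻¹ ≤ Cq * q s) {a s₁ s₂ A B : ℝ} (ha : a ≤ s₁) (h₁₂ : s₁ ≤ s₂) (hB : 0 ≤ B)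
    (hA1 : ∀ s ≤ s₁, A ≤ (r s₂ - r s) * Fr s - F s)
    (hB1 : ∀ s, s₁ ≤ s → s ≤ s₂ → -B ≤ (r s₂ - r s) * Fr s - F s) :
    A * ∫ s in a..s₁, g s * ‖u s‖ ^ 2 ≤ (r s₂ - r a) * (‖w a‖ ^ 2 - F a * ‖u a‖ ^ 2) +
      B * (∫ s in s₁..s₂, ‖u s‖ ^ 2) +
      (r s₂ - rp) ^ 2 * Cq * ∫ s in a..s₂, q s * ‖H s‖ ^ 2 := by
  have hcu := h.continuous_u
  have hcH := h.continuous_H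
  have hcg := hr.continuous_g
  set D := (r s₂ - rp) ^ 2 * Cq with hD
  set Φ : ℝ → ℝ := fun s => (r s₂ - r s) * (‖w s‖ ^ 2 - F s * ‖u s‖ ^ 2) with hΦdef
  have hΦ : ∀ s, HasDerivAt Φ (-g s * ‖w s‖ ^ 2 -
      g s * ((r s₂ - r s) * Fr s - F s) * ‖u s‖ ^ 2 +
      2 * inner ℝ (w s) (((r s₂ - r s : ℝ)) • H s)) s := by
    intro s
    refine (((hr.hasDeriv s).const_sub (r s₂)).mul ((h.hasDerivAt_norm_sq_w s).sub
      ((hF s).mul (h.hasDerivAt_norm_sq_u s)))).congr_deriv ?_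
    rw [inner_smul_right]
    simp only [Pi.sub_apply, Pi.mul_apply]
    ring
  have hsrc : ∀ s ≤ s₂, -g s * ‖w s‖ ^ 2 + 2 * inner ℝ (w s) (((r s₂ - r s : ℝ)) • H s) ≤
      D * (q s * ‖H s‖ ^ 2) := by
    intro s hs
    have h1 := two_mul_inner_le (x := w s) (y := ((r s₂ - r s : ℝ)) • H s) (hr.g_pos s)
    rw [norm_smul, mul_pow, Real.norm_eq_abs, sq_abs] at h1
    have h2 : (r s₂ - r s) ^ 2 ≤ (r s₂ - rp) ^ 2 := by
      have := hr.strictMono.monotone hs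
      have := hr.lt s
      apply pow_le_pow_left₀ <;> linarith
    have h3 : (g s)⁻¹ * ((r s₂ - r s) ^ 2 * ‖H s‖ ^ 2) ≤
        Cq * q s * ((r s₂ - rp) ^ 2 * ‖H s‖ ^ 2) := by
      have := hr.g_pos s
      have := hq s
      gcongr
      exact (inv_pos.2 (hr.g_pos s)).le.trans this
    rw [hD]
    linarith
  have e1 := sub_le_integral_of_hasDerivAt_le ha hΦ
    (φ := fun s => -A * (g s * ‖u s‖ ^ 2) + D * (q s * ‖H s‖ ^ 2)) (by fun_prop) (by
      intro s hs
      have h1 := hsrc s (hs.2.trans h₁₂)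
      have h2 := mul_le_mul_of_nonneg_left (hA1 s hs.2)
        (mul_nonneg (hr.g_pos s).le (sq_nonneg ‖u s‖))
      linarith)
  have e2 := sub_le_integral_of_hasDerivAt_le h₁₂ hΦ
    (φ := fun s => B * ‖u s‖ ^ 2 + D * (q s * ‖H s‖ ^ 2)) (by fun_prop) (by
      intro s hs
      have h1 := hsrc s hs.2
      have h2 := mul_le_mul_of_nonneg_left (hB1 s hs.1 hs.2)
        (mul_nonneg (hr.g_pos s).le (sq_nonneg ‖u s‖))
      have h3 := mul_le_mul_of_nonneg_right (hr.g_le_one s)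
        (mul_nonneg hB (sq_nonneg ‖u s‖))
      linarith)
  rw [intervalIntegral.integral_add (Continuous.intervalIntegrable (by fun_prop) _ _)
    (Continuous.intervalIntegrable (by fun_prop) _ _), intervalIntegral.integral_const_mul,
    intervalIntegral.integral_const_mul] at e1 e2
  have e3 := intervalIntegral.integral_add_adjacent_intervals (μ := volume) (a := a) (b := s₁)
    (c := s₂) (f := fun s => q s * ‖H s‖ ^ 2) (Continuous.intervalIntegrable (by fun_prop) _ _)
    (Continuous.intervalIntegrable (by fun_prop) _ _)
  have e4 : Φ s₂ = 0 := by simp [hΦdef]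
  have e5 : Φ a = (r s₂ - r a) * (‖w a‖ ^ 2 - F a * ‖u a‖ ^ 2) := rfl
  rw [← e3, mul_add]
  linarith

/-- The localized Agmon inequality for a single weight `ψ`. -/
theorem agmon_weight (h : RadialSolution ω F H u v w) {ψ ψ' ℓ : ℝ → ℝ}
    (hψ : ∀ s, HasDerivAt ψ (ψ' s) s) (hℓ : Continuous ℓ) {η D a b : ℝ} (hη : 0 < η)
    (hab : a ≤ b) (hV : ∀ s ∈ Icc a b, 0 < F s - ω ^ 2)
    (hψD : ∀ s ∈ Icc a b, ψ s ^ 2 ≤ 4 * η * D * (F s - ω ^ 2))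
    (hψℓ : ∀ s ∈ Icc a b, ℓ s ≤ (1 - η) * (F s - ω ^ 2) * ψ s ^ 2 - ψ' s ^ 2) :
    (∫ s in a..b, ℓ s * ‖u s‖ ^ 2) - D * ∫ s in a..b, ‖H s‖ ^ 2 ≤
      ψ b ^ 2 * inner ℝ (u b) (v b) - ψ a ^ 2 * inner ℝ (u a) (v a) := by
  have hcu := h.continuous_u
  have hcH := h.continuous_H
  have hΦ : ∀ s, HasDerivAt (fun s => ψ s ^ 2 * inner ℝ (u s) (v s))
      (2 * ψ s * ψ' s * inner ℝ (u s) (v s) +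
        ψ s ^ 2 * (‖v s‖ ^ 2 + (F s - ω ^ 2) * ‖u s‖ ^ 2 + inner ℝ (u s) (H s))) s := by
    intro s
    refine (((hψ s).pow 2).mul (h.hasDerivAt_inner s)).congr_deriv ?_
    simp only [Pi.pow_apply]
    push_cast
    ring
  rw [← intervalIntegral.integral_const_mul, ← intervalIntegral.integral_sub
    (Continuous.intervalIntegrable (by fun_prop) _ _)
    (Continuous.intervalIntegrable (by fun_prop) _ _)]
  refine integral_le_sub_of_le_hasDerivAt hab hΦ (by fun_prop) fun s hs => ?_
  have hVs := hV s hs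
  have h1 : 0 ≤ ‖ψ' s • u s + ψ s • v s‖ ^ 2 := sq_nonneg _
  rw [norm_add_sq_real, norm_smul, norm_smul, mul_pow, mul_pow, Real.norm_eq_abs,
    Real.norm_eq_abs, sq_abs, sq_abs, inner_smul_left, inner_smul_right] at h1
  simp only [conj_trivial] at h1
  have h2 := (abs_le.1 (abs_two_mul_inner_le (x := u s) (y := H s)
    (t := 2 * η * (F s - ω ^ 2)) (by positivity))).1
  have h3 := mul_le_mul_of_nonneg_left h2 (sq_nonneg (ψ s))
  have h4 := mul_le_mul_of_nonneg_right (hψℓ s hs) (sq_nonneg ‖u s‖)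
  have h5 : ψ s ^ 2 * ((2 * η * (F s - ω ^ 2))⁻¹ * ‖H s‖ ^ 2) ≤ 2 * D * ‖H s‖ ^ 2 := by
    rw [← mul_assoc]
    refine mul_le_mul_of_nonneg_right ?_ (sq_nonneg _)
    rw [← div_eq_mul_inv, div_le_iff₀ (by positivity)]
    linarith [hψD s hs]
  linarith

/-- Agmon estimate through the whole barrier. -/
theorem agmon_estimate (h : RadialSolution ω F H u v w) (hr : InverseTortoise rp b r g)
    {η Λ β c D s₁ s₂ s₃ : ℝ} (hrp : 0 < rp) (hη : 0 < η) (hη1 : η ≤ 1 / 2) (hΛ : 1 ≤ Λ)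
    (hβ1 : 1 ≤ β)
    (hβ : β ^ 2 ≤ (1 - η) ^ 2 * Λ) (hc : 0 < c) (h₁₂ : s₁ ≤ s₂) (h₂₃ : s₂ ≤ s₃)
    (hr2 : 1 ≤ r s₂) (hD1 : 1 ≤ 4 * η * D * c) (hD2 : 8 * r s₂ ^ 2 ≤ 4 * η * D)
    (hV1 : ∀ s ∈ Icc (s₁ - 1) s₂, c * Λ ≤ F s - ω ^ 2)
    (hV2 : ∀ s ∈ Icc s₂ (s₃ + 1), (1 - η) * (Λ / r s ^ 2) ≤ F s - ω ^ 2) :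
    (1 - η) * c * Λ * ∫ s in s₁..s₂, ‖u s‖ ^ 2 ≤
      (∫ s in (s₁ - 1)..s₁, ‖u s‖ ^ 2) +
      Real.exp (-β * Real.log (r s₃ / r s₂)) ^ 2 * (∫ s in s₃..(s₃ + 1), ‖u s‖ ^ 2) +
      D * ∫ s in (s₁ - 1)..(s₃ + 1), ‖H s‖ ^ 2 := by
  have hcu := h.continuous_u
  have hcH := h.continuous_H
  set K := Real.exp (-β * Real.log (r s₃ / r s₂)) with hK
  have hr2pos : 0 < r s₂ := by linarith
  have hΛ0 : 0 < Λ := by linarith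
  have hD0 : 0 < 4 * η * D := lt_of_lt_of_le (by positivity) hD2
  have hcΛ : c ≤ c * Λ := le_mul_of_one_le_right hc.le hΛ
  have hrge : ∀ s, s₂ ≤ s → r s₂ ≤ r s := fun s hs => hr.strictMono.monotone hs
  have hVpos1 : ∀ s ∈ Icc (s₁ - 1) s₂, 0 < F s - ω ^ 2 := fun s hs => by
    linarith [hV1 s hs]
  have hVpos2 : ∀ s ∈ Icc s₂ (s₃ + 1), 0 < F s - ω ^ 2 := fun s hs => by
    refine lt_of_lt_of_le ?_ (hV2 s hs)
    have := hrge s hs.1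
    have : 0 < r s := by linarith
    have : 0 < 1 - η := by linarith
    positivity
  have hD3 : ∀ s ∈ Icc (s₁ - 1) s₂, 1 ≤ 4 * η * D * (F s - ω ^ 2) := fun s hs =>
    hD1.trans (mul_le_mul_of_nonneg_left (hcΛ.trans (hV1 s hs)) hD0.le)
  have hdecay : ∀ s, s₂ ≤ s → Real.exp (-β * Real.log (r s / r s₂)) ≤ r s₂ / r s := by
    intro s hs
    have h1 : 0 < r s := hr2pos.trans_le (hrge s hs)
    have h2 : 0 ≤ Real.log (r s / r s₂) :=
      Real.log_nonneg ((one_le_div hr2pos).2 (hrge s hs))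
    calc Real.exp (-β * Real.log (r s / r s₂)) ≤ Real.exp (-Real.log (r s / r s₂)) := by
          apply Real.exp_le_exp.2; nlinarith
      _ = r s₂ / r s := by
          rw [Real.exp_neg, Real.exp_log (by positivity), inv_div]
  have hD4 : ∀ s ∈ Icc s₂ (s₃ + 1), 4 * (r s₂ / r s) ^ 2 ≤ 4 * η * D * (F s - ω ^ 2) := by
    intro s hs
    have h1 : 0 < r s := hr2pos.trans_le (hrge s hs.1)
    have h2 : 1 / 2 * (1 / r s ^ 2) ≤ F s - ω ^ 2 := by
      refine le_trans ?_ (hV2 s hs)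
      gcongr <;> linarith
    calc 4 * (r s₂ / r s) ^ 2 = 8 * r s₂ ^ 2 * (1 / 2 * (1 / r s ^ 2)) := by
          field_simp; ring
      _ ≤ 4 * η * D * (F s - ω ^ 2) := by gcongr
  have p1 := h.agmon_weight (ψ := fun s => s - (s₁ - 1)) (ψ' := fun _ => 1) (ℓ := fun _ => -1)
    (a := s₁ - 1) (b := s₁) (η := η) (D := D) (fun s => (hasDerivAt_id s).sub_const _)
    continuous_const hη (by linarith) (fun s hs => hVpos1 s ⟨hs.1, hs.2.trans h₁₂⟩)
    (fun s hs => by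
      refine le_trans ?_ (hD3 s ⟨hs.1, hs.2.trans h₁₂⟩)
      apply pow_le_one₀ <;> linarith [hs.1, hs.2])
    (fun s hs => by
      have h1 := hVpos1 s ⟨hs.1, hs.2.trans h₁₂⟩
      have h2 : 0 ≤ 1 - η := by linarith
      have h3 : 0 ≤ (1 - η) * (F s - ω ^ 2) * (s - (s₁ - 1)) ^ 2 := by positivity
      linarith)
  have p2 := h.agmon_weight (ψ := fun _ => 1) (ψ' := fun _ => 0)
    (ℓ := fun _ => (1 - η) * c * Λ) (a := s₁) (b := s₂) (η := η) (D := D)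
    (fun s => hasDerivAt_const _ _)
    continuous_const hη h₁₂ (fun s hs => hVpos1 s ⟨by linarith [hs.1], hs.2⟩)
    (fun s hs => by
      have := hD3 s ⟨by linarith [hs.1], hs.2⟩
      linarith)
    (fun s hs => by
      have h1 := hV1 s ⟨by linarith [hs.1], hs.2⟩
      have h2 : 0 ≤ 1 - η := by linarith
      have := mul_le_mul_of_nonneg_left h1 h2
      linarith)
  have p3 := h.agmon_weight (ψ := fun s => Real.exp (-β * Real.log (r s / r s₂)))
    (ψ' := fun s => Real.exp (-β * Real.log (r s / r s₂)) * (-β * (g s / r s)))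
    (ℓ := fun _ => 0) (a := s₂) (b := s₃) (η := η) (D := D)
    (fun s => by
      have h0 : 0 < r s := hrp.trans (hr.lt s)
      refine (((((hr.hasDeriv s).div_const (r s₂)).log (by positivity)).const_mul
        (-β)).exp).congr_deriv ?_
      field_simp)
    continuous_const hη h₂₃ (fun s hs => hVpos2 s ⟨hs.1, by linarith [hs.2]⟩)
    (fun s hs => by
      refine le_trans ?_ (hD4 s ⟨hs.1, by linarith [hs.2]⟩)
      have h1 := hdecay s hs.1
      have h2 := pow_le_pow_left₀ (Real.exp_nonneg _) h1 2
      linarith [sq_nonneg (r s₂ / r s)])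
    (fun s hs => by
      have h1 := hV2 s ⟨hs.1, by linarith [hs.2]⟩
      have h0 : 0 < r s := hr2pos.trans_le (hrge s hs.1)
      have h2 : 0 ≤ 1 - η := by linarith
      have h3 : (β * (g s / r s)) ^ 2 ≤ (1 - η) * (F s - ω ^ 2) := by
        have hg : (g s / r s) ^ 2 ≤ (1 / r s) ^ 2 := by
          have := hr.g_pos s
          have := hr.g_le_one s
          gcongr
        calc (β * (g s / r s)) ^ 2 = β ^ 2 * (g s / r s) ^ 2 := by ring
          _ ≤ ((1 - η) ^ 2 * Λ) * (1 / r s) ^ 2 := by gcongr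
          _ = (1 - η) * ((1 - η) * (Λ / r s ^ 2)) := by ring
          _ ≤ _ := by gcongr
      have h4 := mul_le_mul_of_nonneg_right h3
        (sq_nonneg (Real.exp (-β * Real.log (r s / r s₂))))
      nlinarith)
  have p4 := h.agmon_weight (ψ := fun s => K * (s₃ + 1 - s)) (ψ' := fun _ => K * -1)
    (ℓ := fun _ => -K ^ 2) (a := s₃) (b := s₃ + 1) (η := η) (D := D)
    (fun s => ((hasDerivAt_id s).const_sub _).const_mul K)
    continuous_const hη (by linarith) (fun s hs => hVpos2 s ⟨by linarith [hs.1], hs.2⟩)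
    (fun s hs => by
      have hs' : s ∈ Icc s₂ (s₃ + 1) := ⟨by linarith [hs.1], hs.2⟩
      refine le_trans ?_ (hD4 s hs')
      have h0 : 0 < r s := hr2pos.trans_le (hrge s hs'.1)
      have h1 : r s ≤ r s₃ + 1 := by
        have := sub_le_integral_of_hasDerivAt_le hs.1 hr.hasDeriv (φ := fun _ => 1)
          continuous_const fun s _ => hr.g_le_one s
        simp at this
        linarith [hs.2]
      have h3 : 1 ≤ r s₃ := hr2.trans (hrge _ h₂₃)
      have h4 : K ≤ 2 * (r s₂ / r s) := by
        refine (hdecay s₃ h₂₃).trans ?_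
        rw [← mul_div_assoc, div_le_div_iff₀ (by linarith) h0]
        nlinarith
      have h5 : (s₃ + 1 - s) ^ 2 ≤ 1 := by
        apply pow_le_one₀ <;> linarith [hs.1, hs.2]
      have h6 := pow_le_pow_left₀ (Real.exp_nonneg _) h4 2
      calc (K * (s₃ + 1 - s)) ^ 2 = K ^ 2 * (s₃ + 1 - s) ^ 2 := by ring
        _ ≤ K ^ 2 * 1 := by gcongr
        _ ≤ _ := by linarith)
    (fun s hs => by
      have h1 := hVpos2 s ⟨by linarith [hs.1], hs.2⟩
      have h2 : 0 ≤ 1 - η := by linarith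
      have h3 : 0 ≤ (1 - η) * (F s - ω ^ 2) * (K * (s₃ + 1 - s)) ^ 2 := by positivity
      linarith)
  have hHi : ∀ x y : ℝ, IntervalIntegrable (fun s => ‖H s‖ ^ 2) volume x y := fun x y =>
    Continuous.intervalIntegrable (by fun_prop) _ _
  have e1 := intervalIntegral.integral_add_adjacent_intervals (hHi (s₁ - 1) s₁) (hHi s₁ s₂)
  have e2 := intervalIntegral.integral_add_adjacent_intervals (hHi (s₁ - 1) s₂) (hHi s₂ s₃)
  have e3 := intervalIntegral.integral_add_adjacent_intervals (hHi (s₁ - 1) s₃)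
    (hHi s₃ (s₃ + 1))
  simp only [intervalIntegral.integral_const_mul, zero_mul, intervalIntegral.integral_zero,
    ← hK, div_self hr2pos.ne', Real.log_one, mul_zero, Real.exp_zero] at p1 p2 p3 p4
  rw [← e3, ← e2, ← e1]
  ring_nf at p1 p2 p3 p4 ⊢
  linarith

theorem weighted_estimate (h : RadialSolution ω F H u v w) (hr : InverseTortoise rp b r g)
    (hqc : Continuous q) {Cq C a a₀ S : ℝ} (hq : ∀ s, (g s)⁻¹ ≤ Cq * q s)
    (hFg : ∀ s ≤ S, F s ^ 2 ≤ C * g s ^ 2) (ha : a ≤ a₀) (haS : a₀ ≤ S) :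
    ∫ s in a₀..S, g s / (r s - rp) ^ 2 * ‖w s‖ ^ 2 ≤
      8 * ((r a₀ - rp)⁻¹ * ‖w a‖ ^ 2 + 4 * C * (∫ s in a..S, g s * ‖u s‖ ^ 2) +
        4 * Cq * ∫ s in a..S, q s * ‖H s‖ ^ 2) := by
  have hcu := h.continuous_u
  have hcw := h.continuous_w
  have hcH := h.continuous_H
  have hcg := hr.continuous_g
  have hcr : Continuous r := continuous_iff_continuousAt.2 fun s => (hr.hasDeriv s).continuousAt
  set ε := r a₀ - rp with hε
  have hε0 : 0 < ε := sub_pos.2 (hr.lt a₀)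
  have hx : ∀ s, 0 < r s - rp := fun s => sub_pos.2 (hr.lt s)
  have hy : ∀ s, 0 < r s - rp + ε := fun s => add_pos (hx s) hε0
  set y : ℝ → ℝ := fun s => (r s - rp + ε)⁻¹ with hydef
  have hypos : ∀ s, 0 < y s := fun s => inv_pos.2 (hy s)
  have hyc : Continuous y := (by fun_prop : Continuous fun s => r s - rp + ε).inv₀
    fun s => (hy s).ne'
  have hΦ : ∀ s, HasDerivAt (fun s => y s * ‖w s‖ ^ 2) (-(g s * y s ^ 2 * ‖w s‖ ^ 2) +
      2 * inner ℝ (y s • w s) (F s • u s) + 2 * inner ℝ (y s • w s) (H s)) s := by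
    intro s
    have h1 : HasDerivAt y (-(g s * y s ^ 2)) s := by
      refine (((hr.hasDeriv s).sub_const rp).add_const ε).inv (hy s).ne' |>.congr_deriv ?_
      simp only [hydef, inv_pow]
      ring
    refine (h1.mul (h.hasDerivAt_norm_sq_w s)).congr_deriv ?_
    simp only [inner_smul_left, inner_smul_right, conj_trivial]
    rw [real_inner_comm (u s) (w s)]
    ring
  have key := sub_le_integral_of_hasDerivAt_le (ha.trans haS) hΦ
    (φ := fun s => -(1 / 2) * (g s * y s ^ 2 * ‖w s‖ ^ 2) + (4 * C * (g s * ‖u s‖ ^ 2) +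
      4 * Cq * (q s * ‖H s‖ ^ 2))) (by fun_prop) (by
    intro s hs
    have hg := hr.g_pos s
    have h1 := two_mul_inner_le (x := y s • w s) (y := F s • u s) (t := g s / 4) (by positivity)
    have h2 := two_mul_inner_le (x := y s • w s) (y := H s) (t := g s / 4) (by positivity)
    simp only [norm_smul, mul_pow, Real.norm_eq_abs, sq_abs] at h1 h2
    have h3 : (g s / 4)⁻¹ * (F s ^ 2 * ‖u s‖ ^ 2) ≤ 4 * C * (g s * ‖u s‖ ^ 2) := by
      calc (g s / 4)⁻¹ * (F s ^ 2 * ‖u s‖ ^ 2) ≤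
            (g s / 4)⁻¹ * (C * g s ^ 2 * ‖u s‖ ^ 2) := by
            have := hFg s hs.2
            gcongr
        _ = _ := by field_simp
    have h4 : (g s / 4)⁻¹ * ‖H s‖ ^ 2 ≤ 4 * Cq * (q s * ‖H s‖ ^ 2) := by
      calc (g s / 4)⁻¹ * ‖H s‖ ^ 2 = 4 * ((g s)⁻¹ * ‖H s‖ ^ 2) := by
            field_simp
        _ ≤ 4 * ((Cq * q s) * ‖H s‖ ^ 2) := by
            have := hq s
            gcongr
        _ = _ := by ring
    linarith)
  have hi : ∀ x z, IntervalIntegrable (fun s => g s * y s ^ 2 * ‖w s‖ ^ 2) volume x z :=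
    fun x z => Continuous.intervalIntegrable (by fun_prop) _ _
  rw [intervalIntegral.integral_add (Continuous.intervalIntegrable (by fun_prop) _ _)
    (Continuous.intervalIntegrable (by fun_prop) _ _), intervalIntegral.integral_add
    (Continuous.intervalIntegrable (by fun_prop) _ _)
    (Continuous.intervalIntegrable (by fun_prop) _ _), intervalIntegral.integral_const_mul,
    intervalIntegral.integral_const_mul, intervalIntegral.integral_const_mul,
    ← intervalIntegral.integral_add_adjacent_intervals (hi a a₀) (hi a₀ S)] at key
  have h1 : 0 ≤ ∫ s in a..a₀, g s * y s ^ 2 * ‖w s‖ ^ 2 :=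
    intervalIntegral.integral_nonneg ha fun s _ => by have := hr.g_pos s; positivity
  have h2 : 0 ≤ y S * ‖w S‖ ^ 2 := by have := hypos S; positivity
  have h3 : y a * ‖w a‖ ^ 2 ≤ ε⁻¹ * ‖w a‖ ^ 2 := by
    gcongr
    exact inv_anti₀ hε0 (by linarith [hx a])
  have h4 : ∫ s in a₀..S, g s / (r s - rp) ^ 2 * ‖w s‖ ^ 2 ≤
      ∫ s in a₀..S, 4 * (g s * y s ^ 2 * ‖w s‖ ^ 2) := by
    refine intervalIntegral.integral_mono_on haS (Continuous.intervalIntegrable ?_ _ _)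
      (Continuous.intervalIntegrable (by fun_prop) _ _) fun s hs => ?_
    · exact (hcg.div (by fun_prop) fun s => by have := hx s; positivity).mul (by fun_prop)
    · have hxs := hx s
      have hg := hr.g_pos s
      have hmono : r a₀ ≤ r s := hr.strictMono.monotone hs.1
      have h5 : 1 / (2 * (r s - rp)) ≤ y s := by
        simp only [hydef, one_div]
        exact inv_anti₀ (hy s) (by linarith)
      calc g s / (r s - rp) ^ 2 * ‖w s‖ ^ 2 =
            4 * (g s * (1 / (2 * (r s - rp))) ^ 2 * ‖w s‖ ^ 2) := by field_simp; ring
        _ ≤ _ := by gcongr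
  rw [intervalIntegral.integral_const_mul] at h4
  linarith

theorem norm_sq_le_of_le (h : RadialSolution ω F H u v w) (hr : InverseTortoise rp b r g)
    {s t S : ℝ} (hst : s ≤ t) (htS : t ≤ S) :
    ‖u s‖ ^ 2 ≤ Real.exp (r S - rp) * (‖u t‖ ^ 2 + ∫ x in s..t, (g x)⁻¹ * ‖w x‖ ^ 2) := by
  have hcw := h.continuous_w
  have hcg := hr.continuous_g
  have hgi : Continuous fun s => (g s)⁻¹ := hcg.inv₀ fun s => (hr.g_pos s).ne'
  have hΦ : ∀ x, HasDerivAt (fun x => Real.exp (r x) * ‖u x‖ ^ 2)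
      (Real.exp (r x) * (g x * ‖u x‖ ^ 2 + 2 * inner ℝ (u x) (w x))) x := by
    intro x
    refine ((hr.hasDeriv x).exp.mul (h.hasDerivAt_norm_sq_u x)).congr_deriv ?_
    ring
  have key := integral_le_sub_of_le_hasDerivAt hst hΦ
    (φ := fun x => -Real.exp (r t) * ((g x)⁻¹ * ‖w x‖ ^ 2)) (by fun_prop) (by
    intro x hx
    have hg := hr.g_pos x
    have h1 := (abs_le.1 (abs_two_mul_inner_le (x := u x) (y := w x) hg)).1
    have h2 : Real.exp (r x) ≤ Real.exp (r t) :=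
      Real.exp_le_exp.2 (hr.strictMono.monotone hx.2)
    have h3 : 0 ≤ (g x)⁻¹ * ‖w x‖ ^ 2 := by positivity
    have h4 := mul_le_mul_of_nonneg_right h2 h3
    have h5 := mul_le_mul_of_nonneg_left h1 (Real.exp_pos (r x)).le
    linarith)
  rw [intervalIntegral.integral_const_mul] at key
  have hI : 0 ≤ ∫ x in s..t, (g x)⁻¹ * ‖w x‖ ^ 2 :=
    intervalIntegral.integral_nonneg hst fun x _ => by have := hr.g_pos x; positivity
  have h1 : Real.exp (r s) * ‖u s‖ ^ 2 ≤
      Real.exp (r t) * (‖u t‖ ^ 2 + ∫ x in s..t, (g x)⁻¹ * ‖w x‖ ^ 2) := by linarith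
  have h2 : Real.exp (r t) ≤ Real.exp (r S - rp) * Real.exp (r s) := by
    rw [← Real.exp_add]
    apply Real.exp_le_exp.2
    have := hr.strictMono.monotone htS
    have := hr.lt s
    linarith
  have h3 := mul_le_mul_of_nonneg_right h2 (add_nonneg (sq_nonneg ‖u t‖) hI)
  refine le_of_mul_le_mul_left ?_ (Real.exp_pos (r s))
  linarith

theorem local_bound (h : RadialSolution ω F H u v w) (hr : InverseTortoise rp b r g)
    (hqc : Continuous q) {Cw Iw m a₀ S : ℝ} {G θ : ℝ → ℝ} (hω : 0 < ω) (hωm : ω < m)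
    (hGc : Continuous G) (hCw : 0 ≤ Cw)
    (hG : ∀ s ≤ S, (g s)⁻¹ ≤ Cw * G s) (hqG : ∀ s ≤ S, q s ≤ Cw * G s)
    (hθc : Continuous θ) (hθ0 : ∀ s, 0 ≤ θ s) (hθ1 : ∀ s, θ s ≤ 1)
    (hθI : ∫ s in a₀..(S - 1), θ s ≤ Iw) (haS : a₀ ≤ S - 1) :
    ∫ s in a₀..S, (q s * ‖w s‖ ^ 2 + θ s * (‖v s‖ ^ 2 + ‖u s‖ ^ 2)) ≤
      (3 * Cw + (2 * m ^ 2 + 1) * (Iw * Real.exp (r S - rp) * (1 + Cw) + 1)) *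
        ((∫ s in a₀..S, G s * ‖w s‖ ^ 2) + ∫ s in (S - 1)..S, ‖u s‖ ^ 2) := by
  have hcu := h.continuous_u
  have hcv := h.continuous_v
  have hcw := h.continuous_w
  have hcg := hr.continuous_g
  have hgi : Continuous fun s => (g s)⁻¹ := hcg.inv₀ fun s => (hr.g_pos s).ne'
  have hii : ∀ {f : ℝ → ℝ}, Continuous f → ∀ x y, IntervalIntegrable f volume x y :=
    fun hf x y => hf.intervalIntegrable x y
  set W := ∫ s in a₀..S, G s * ‖w s‖ ^ 2 with hW
  set B := ∫ s in (S - 1)..S, ‖u s‖ ^ 2 with hB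
  set X := Real.exp (r S - rp) with hX
  have hX0 : 0 < X := Real.exp_pos _
  have hB0 : 0 ≤ B := intervalIntegral.integral_nonneg (by linarith) fun s _ => sq_nonneg _
  have hCG : ∀ s ≤ S, 0 ≤ Cw * G s := fun s hs => (inv_pos.2 (hr.g_pos s)).le.trans (hG s hs)
  have hgw : ∀ s t, a₀ ≤ s → s ≤ t → t ≤ S →
      ∫ x in s..t, (g x)⁻¹ * ‖w x‖ ^ 2 ≤ Cw * W := by
    intro s t hs hst ht
    calc ∫ x in s..t, (g x)⁻¹ * ‖w x‖ ^ 2 ≤ ∫ x in a₀..S, (g x)⁻¹ * ‖w x‖ ^ 2 := by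
          refine intervalIntegral.integral_mono_interval hs hst ht ?_ (hii (by fun_prop) _ _)
          exact Eventually.of_forall fun x => by
            have := hr.g_pos x
            simp only [Pi.zero_apply]
            positivity
      _ ≤ ∫ x in a₀..S, Cw * (G x * ‖w x‖ ^ 2) := by
          refine intervalIntegral.integral_mono_on (by linarith) (hii (by fun_prop) _ _)
            (hii (by fun_prop) _ _) fun x hx => ?_
          rw [← mul_assoc]
          have := hG x hx.2
          gcongr
      _ = Cw * W := by rw [intervalIntegral.integral_const_mul]
  have hCW0 : 0 ≤ Cw * W :=
    (intervalIntegral.integral_nonneg (by linarith) fun x _ => by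
      have := hr.g_pos x; positivity).trans (hgw a₀ S le_rfl (by linarith) le_rfl)
  have hsup : ∀ s ∈ Icc a₀ (S - 1), ‖u s‖ ^ 2 ≤ X * (B + Cw * W) := by
    intro s hs
    have h1 : ∫ t in (S - 1)..S, ‖u s‖ ^ 2 ≤
        ∫ t in (S - 1)..S, X * (‖u t‖ ^ 2 + Cw * W) := by
      refine intervalIntegral.integral_mono_on (by linarith) (hii (by fun_prop) _ _)
        (hii (by fun_prop) _ _) fun t ht => ?_
      have hst : s ≤ t := hs.2.trans ht.1
      refine (h.norm_sq_le_of_le hr hst ht.2).trans ?_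
      have := hgw s t hs.1 hst ht.2
      gcongr
    rw [intervalIntegral.integral_const_mul, intervalIntegral.integral_add
      (hii (by fun_prop) _ _) (hii (by fun_prop) _ _)] at h1
    simpa using h1
  have hpt : ∫ s in a₀..S, (q s * ‖w s‖ ^ 2 + θ s * (‖v s‖ ^ 2 + ‖u s‖ ^ 2)) ≤
      ∫ s in a₀..S, (3 * Cw * (G s * ‖w s‖ ^ 2) +
        (2 * m ^ 2 + 1) * (θ s * ‖u s‖ ^ 2)) := by
    refine intervalIntegral.integral_mono_on (by linarith) (hii (by fun_prop) _ _)
      (hii (by fun_prop) _ _) fun s hs => ?_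
    have h1 : ‖v s‖ ^ 2 ≤ 2 * ‖w s‖ ^ 2 + 2 * m ^ 2 * ‖u s‖ ^ 2 := by
      have e : v s = w s - Complex.I * ω * u s := by rw [h.w_eq]; ring
      have e1 : ‖v s‖ ≤ ‖w s‖ + m * ‖u s‖ := by
        rw [e]
        refine (norm_sub_le _ _).trans ?_
        rw [norm_mul, norm_mul, Complex.norm_I, Complex.norm_real, Real.norm_eq_abs,
          abs_of_pos hω, one_mul]
        gcongr
      have e2 := pow_le_pow_left₀ (norm_nonneg _) e1 2
      nlinarith [sq_nonneg (‖w s‖ - m * ‖u s‖)]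
    have h2 := mul_le_mul_of_nonneg_right (hqG s hs.2) (sq_nonneg ‖w s‖)
    have h3 : 1 ≤ Cw * G s :=
      ((one_le_inv₀ (hr.g_pos s)).2 (hr.g_le_one s)).trans (hG s hs.2)
    have h4 := mul_le_mul_of_nonneg_right h3 (sq_nonneg ‖w s‖)
    have h5 := mul_le_mul_of_nonneg_right (hθ1 s) (sq_nonneg ‖w s‖)
    have h6 := mul_le_mul_of_nonneg_left h1 (hθ0 s)
    linarith
  have hsplit : ∫ s in a₀..S, (3 * Cw * (G s * ‖w s‖ ^ 2) +
      (2 * m ^ 2 + 1) * (θ s * ‖u s‖ ^ 2)) = 3 * Cw * W + (2 * m ^ 2 + 1) *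
        ((∫ s in a₀..(S - 1), θ s * ‖u s‖ ^ 2) + ∫ s in (S - 1)..S, θ s * ‖u s‖ ^ 2) := by
    rw [intervalIntegral.integral_add (hii (by fun_prop) _ _) (hii (by fun_prop) _ _),
      intervalIntegral.integral_const_mul, intervalIntegral.integral_const_mul, ← hW,
      ← intervalIntegral.integral_add_adjacent_intervals (b := S - 1)
        (f := fun s => θ s * ‖u s‖ ^ 2) (hii (by fun_prop) _ _) (hii (by fun_prop) _ _)]
  rw [hsplit] at hpt
  have h1 : ∫ s in a₀..(S - 1), θ s * ‖u s‖ ^ 2 ≤ Iw * (X * (B + Cw * W)) := by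
    calc _ ≤ ∫ s in a₀..(S - 1), θ s * (X * (B + Cw * W)) := by
          refine intervalIntegral.integral_mono_on haS (hii (by fun_prop) _ _)
            (hii (by fun_prop) _ _) fun s hs => ?_
          exact mul_le_mul_of_nonneg_left (hsup s hs) (hθ0 s)
      _ = (∫ s in a₀..(S - 1), θ s) * (X * (B + Cw * W)) := by
          rw [intervalIntegral.integral_mul_const]
      _ ≤ _ := by gcongr
  have h2 : ∫ s in (S - 1)..S, θ s * ‖u s‖ ^ 2 ≤ B := by
    refine intervalIntegral.integral_mono_on (by linarith) (hii (by fun_prop) _ _)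
      (hii (by fun_prop) _ _) fun s hs => ?_
    exact mul_le_of_le_one_left (sq_nonneg _) (hθ1 s)
  have hIw : 0 ≤ Iw := (intervalIntegral.integral_nonneg haS fun s _ => hθ0 s).trans hθI
  have hW0 : 0 ≤ W := intervalIntegral.integral_nonneg (by linarith) fun s hs => by
    have h3 := (inv_pos.2 (hr.g_pos s)).trans_le (hG s hs.2)
    have h4 := pos_of_mul_pos_right h3 hCw
    positivity
  refine hpt.trans ?_
  have h5 : (2 * m ^ 2 + 1) * ((∫ s in a₀..(S - 1), θ s * ‖u s‖ ^ 2) +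
      ∫ s in (S - 1)..S, θ s * ‖u s‖ ^ 2) ≤
      (2 * m ^ 2 + 1) * (Iw * (X * (B + Cw * W)) + B) := by gcongr
  have h6 : 0 ≤ 3 * Cw * B + (2 * m ^ 2 + 1) * (Iw * X * (W + Cw * B) + W) := by positivity
  linarith

end RadialSolution

theorem exists_absorb_bound {A B t c k D : ℝ} (hA : 0 < A) (hB : 0 ≤ B) (ht : 0 < t)
    (hc : 0 < c) (hk : 0 ≤ k) (hD : 0 ≤ D) :
    ∃ K Λ₀, 0 < K ∧ ∀ Λ, Λ₀ ≤ Λ → ∀ N G o h P : ℝ, 0 ≤ G → 0 ≤ o → 0 ≤ h → 0 ≤ P →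
      A * Λ * N ≤ o + B * Λ * G + k * h → c * Λ * G ≤ t * N + P + D * h →
      Λ * (N + G) ≤ K * (o + P + h) := by
  set K₁ := t * A⁻¹ * (1 + k) + 1 + D with hK₁
  have hA' : 0 < A⁻¹ := inv_pos.2 hA
  have hK₁0 : 0 < K₁ := by positivity
  refine ⟨2 * K₁ / c + A⁻¹ * (1 + k + B * (2 * K₁ / c)), max 1 (2 * (t * A⁻¹ * B) / c),
    by positivity, ?_⟩
  intro Λ hΛ N G o h P hG ho hh hP h1 h2
  have hΛ1 : 1 ≤ Λ := (le_max_left _ _).trans hΛ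
  have hΛ2 : 2 * (t * A⁻¹ * B) ≤ c * Λ := by
    have := (le_max_right _ _).trans hΛ
    rw [div_le_iff₀ hc] at this
    linarith
  have hN : Λ * N ≤ A⁻¹ * (o + B * (Λ * G) + k * h) := by
    rw [inv_mul_eq_div, le_div_iff₀ hA]
    linarith
  have hN' : N ≤ A⁻¹ * (o + B * G + k * h) := by
    refine le_of_mul_le_mul_left ?_ (lt_of_lt_of_le one_pos hΛ1)
    refine hN.trans ?_
    have h3 : o + k * h ≤ Λ * (o + k * h) := le_mul_of_one_le_left (by positivity) hΛ1
    have h4 : o + B * (Λ * G) + k * h ≤ Λ * (o + B * G + k * h) := by linarith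
    calc _ ≤ A⁻¹ * (Λ * (o + B * G + k * h)) := by gcongr
      _ = _ := by ring
  have hG1 : c * (Λ * G) ≤ 2 * (K₁ * (o + P + h)) := by
    have h3 := mul_le_mul_of_nonneg_left hN' ht.le
    have h4 := mul_le_mul_of_nonneg_right hΛ2 hG
    have h5 : 0 ≤ t * A⁻¹ * (1 + k) * P + t * A⁻¹ * k * o + t * A⁻¹ * h + D * (o + P) +
        (o + h) := by positivity
    have h6 : t * (A⁻¹ * (o + k * h)) + P + D * h ≤ K₁ * (o + P + h) := by
      rw [hK₁]; linarith
    linarith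
  have hG2 : Λ * G ≤ 2 * K₁ / c * (o + P + h) := by
    rw [div_mul_eq_mul_div, le_div_iff₀ hc]
    linarith
  have hN2 : Λ * N ≤ A⁻¹ * ((1 + k + B * (2 * K₁ / c)) * (o + P + h)) := by
    refine hN.trans ?_
    have h3 := mul_le_mul_of_nonneg_left hG2 hB
    have h4 : 0 ≤ P + h + k * (o + P) := by positivity
    gcongr
    linarith
  linarith

namespace RadialSolution

variable {ω : ℝ} {F : ℝ → ℝ} {H u v w : ℝ → ℂ} {rp b : ℝ} {r g q : ℝ → ℝ}

theorem weighted_estimate_of_core (h : RadialSolution ω F H u v w)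
    (hr : InverseTortoise rp b r g) (hqc : Continuous q) {Cq C K Λ P X s₁ s₂ S a₀ : ℝ}
    {o : ℝ → ℝ} (hq : ∀ s, (g s)⁻¹ ≤ Cq * q s) (hFg : ∀ s ≤ S, F s ^ 2 ≤ C * Λ ^ 2 * g s ^ 2)
    (hCq : 0 ≤ Cq) (hC : 0 ≤ C) (hK : 0 ≤ K) (hΛ : 1 ≤ Λ) (hP : 0 ≤ P) (hX : 0 ≤ X)
    (h₁ : s₁ ≤ S - 1) (h₂ : S ≤ s₂) (hw : Tendsto w atBot (nhds 0))
    (ho : Tendsto o atBot (nhds 0))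
    (hcore : ∀ a ≤ s₁ - 1, Λ * ((∫ s in a..s₁, g s * ‖u s‖ ^ 2) + ∫ s in s₁..s₂, ‖u s‖ ^ 2) ≤
      K * (o a + P + X))
    (hH : ∀ a ≤ S, ∫ s in a..S, q s * ‖H s‖ ^ 2 ≤ X) (ha₀ : a₀ ≤ S) :
    (∫ s in a₀..S, g s / (r s - rp) ^ 2 * ‖w s‖ ^ 2) + (∫ s in (S - 1)..S, ‖u s‖ ^ 2) ≤
      (32 * C * K + 32 * Cq + K) * Λ * (P + X) := by
  have hcu := h.continuous_u
  have hcg := hr.continuous_g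
  have hii : ∀ {f : ℝ → ℝ}, Continuous f → ∀ x y, IntervalIntegrable f volume x y :=
    fun hf x y => hf.intervalIntegrable x y
  have hG : ∀ a ≤ s₁, 0 ≤ ∫ s in a..s₁, g s * ‖u s‖ ^ 2 := fun a ha =>
    intervalIntegral.integral_nonneg ha fun s _ => by have := hr.g_pos s; positivity
  have hu : ∀ x y, x ≤ y → 0 ≤ ∫ s in x..y, ‖u s‖ ^ 2 := fun x y hxy =>
    intervalIntegral.integral_nonneg hxy fun s _ => sq_nonneg _
  have hI : ∀ a ≤ s₁, ∫ s in a..S, g s * ‖u s‖ ^ 2 ≤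
      (∫ s in a..s₁, g s * ‖u s‖ ^ 2) + ∫ s in s₁..s₂, ‖u s‖ ^ 2 := by
    intro a ha
    rw [← intervalIntegral.integral_add_adjacent_intervals (b := s₁) (hii (by fun_prop) _ _)
      (hii (by fun_prop) _ _), ← intervalIntegral.integral_add_adjacent_intervals (a := s₁)
      (b := S) (c := s₂) (hii (by fun_prop) _ _) (hii (by fun_prop) _ _)]
    have h3 : ∫ s in s₁..S, g s * ‖u s‖ ^ 2 ≤ ∫ s in s₁..S, ‖u s‖ ^ 2 :=
      intervalIntegral.integral_mono_on (by linarith) (hii (by fun_prop) _ _)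
        (hii (by fun_prop) _ _) fun s _ =>
          mul_le_of_le_one_left (sq_nonneg _) (hr.g_le_one s)
    linarith [hu S s₂ h₂]
  have hW : ∫ s in a₀..S, g s / (r s - rp) ^ 2 * ‖w s‖ ^ 2 ≤
      8 * ((r a₀ - rp)⁻¹ * 0 + 4 * (C * Λ) * (K * (0 + P + X)) + 4 * Cq * X) := by
    have hlim : Tendsto (fun a => 8 * ((r a₀ - rp)⁻¹ * ‖w a‖ ^ 2 +
        4 * (C * Λ) * (K * (o a + P + X)) + 4 * Cq * X)) atBot
        (nhds (8 * ((r a₀ - rp)⁻¹ * 0 + 4 * (C * Λ) * (K * (0 + P + X)) + 4 * Cq * X))) := by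
      have hw2 : Tendsto (fun a => ‖w a‖ ^ 2) atBot (nhds 0) := by
        simpa using hw.norm.pow 2
      exact (((hw2.const_mul _).add ((((ho.add_const P).add_const X).const_mul K).const_mul
        _)).add_const _).const_mul 8
    refine ge_of_tendsto hlim ?_
    filter_upwards [eventually_le_atBot (s₁ - 1), eventually_le_atBot a₀] with a ha1 ha2
    refine (h.weighted_estimate hr hqc hq hFg ha2 ha₀).trans ?_
    have h3 := hH a (ha2.trans ha₀)
    have h4 : 4 * (C * Λ ^ 2) * (∫ s in a..S, g s * ‖u s‖ ^ 2) ≤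
        4 * (C * Λ) * (K * (o a + P + X)) := by
      have h5 := mul_le_mul_of_nonneg_left (hI a (by linarith)) (zero_le_one.trans hΛ)
      calc 4 * (C * Λ ^ 2) * (∫ s in a..S, g s * ‖u s‖ ^ 2) =
            4 * (C * Λ) * (Λ * ∫ s in a..S, g s * ‖u s‖ ^ 2) := by ring
        _ ≤ _ := by
          have := h5.trans (hcore a ha1)
          gcongr
    gcongr
  have hB : ∫ s in (S - 1)..S, ‖u s‖ ^ 2 ≤ K * (0 + P + X) := by
    refine ge_of_tendsto (((ho.add_const P).add_const X).const_mul K) ?_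
    filter_upwards [eventually_le_atBot (s₁ - 1)] with a ha
    refine le_trans ?_ (hcore a ha)
    have h3 : ∫ s in (S - 1)..S, ‖u s‖ ^ 2 ≤ ∫ s in s₁..s₂, ‖u s‖ ^ 2 :=
      intervalIntegral.integral_mono_interval h₁ (by linarith) h₂
        (Eventually.of_forall fun x => sq_nonneg _) (hii (by fun_prop) _ _)
    have h4 := hG a (by linarith)
    have h5 := hu s₁ s₂ (by linarith)
    refine h3.trans ?_
    nlinarith
  have h6 : K * (P + X) ≤ Λ * (K * (P + X)) := le_mul_of_one_le_left (by positivity) hΛ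
  have h7 : Cq * X ≤ Λ * (Cq * X) := le_mul_of_one_le_left (by positivity) hΛ
  have h8 : 0 ≤ Λ * (Cq * P) := by positivity
  linarith

end RadialSolution

theorem eventually_mul_exp_le {a R δ : ℝ} (ha : 0 < a) (hR : 0 < R) (hδ : 0 < δ) (hδ1 : δ < 1) :
    ∀ᶠ Λ : ℝ in atTop, ∀ z, a * Λ / 4 ≤ z →
      Λ * Real.exp (-((1 - δ / 8) * Real.sqrt Λ) * Real.log (z / R)) ^ 2 ≤
        Real.exp (-(4 - δ) * Real.sqrt Λ * Real.log (Real.sqrt Λ)) := by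
  have hlog := (Real.tendsto_log_atTop.comp Real.tendsto_sqrt_atTop).eventually_ge_atTop
    (8 * |Real.log (a / (4 * R))| / δ)
  filter_upwards [hlog, Real.tendsto_sqrt_atTop.eventually_ge_atTop (8 / δ),
    eventually_ge_atTop 1] with Λ h1 h2 hΛ z hz
  have hΛ0 : 0 < Λ := by linarith
  simp only [Function.comp_apply] at h1
  set x := Real.sqrt Λ with hx
  have hx0 : 0 < x := Real.sqrt_pos.2 hΛ0
  have hxx : x ^ 2 = Λ := Real.sq_sqrt hΛ0.le
  rw [div_le_iff₀ hδ] at h1 h2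
  have hz1 : 2 * Real.log x + Real.log (a / (4 * R)) ≤ Real.log (z / R) := by
    have e : 2 * Real.log x = Real.log (x ^ 2) := by
      rw [Real.log_pow]; norm_num
    rw [e, ← Real.log_mul (by positivity) (by positivity), hxx]
    apply Real.log_le_log (by positivity)
    rw [← mul_div_assoc, div_le_div_iff₀ (by positivity) hR]
    nlinarith
  have hlx : 0 ≤ Real.log x := by
    have := abs_nonneg (Real.log (a / (4 * R)))
    nlinarith
  have hκ := neg_abs_le (Real.log (a / (4 * R)))
  have e1 : Λ = Real.exp (2 * Real.log x) := by
    rw [two_mul, Real.exp_add, Real.exp_log hx0, ← sq, hxx]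
  rw [← Real.exp_nat_mul]
  nth_rewrite 1 [e1]
  rw [← Real.exp_add]
  apply Real.exp_le_exp.2
  have h3 : (1 - δ / 8) * x * (2 * Real.log x - δ * Real.log x / 8) ≤
      (1 - δ / 8) * x * Real.log (z / R) := by
    have : 0 ≤ 1 - δ / 8 := by linarith
    gcongr
    linarith
  have h4 : 8 * Real.log x ≤ x * δ * Real.log x := by gcongr
  have h5 : 0 ≤ δ * δ * (x * Real.log x) := by positivity
  push_cast
  nlinarith

theorem exists_radialF_multiplier_bounds {M m E rm rp : ℝ} (hM : 0 < M) (hm0 : 0 ≤ rm)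
    (hmp : rm < rp) (hsum : rm + rp = 2 * M) (hprod : rm * rp = E ^ 2) (hE : E ^ 2 < M * rp) :
    ∃ ρ ε A B, rp < ρ ∧ 0 < ε ∧ 0 < A ∧ 0 < B ∧ ∀ Λ, 1 ≤ Λ → ∀ r, rp < r →
      (r ≤ rp + ε → A * Λ ≤ (ρ - r) * radialFDeriv M m E Λ r - radialF M m E Λ r) ∧
      (r ≤ ρ → -(B * Λ) ≤ (ρ - r) * radialFDeriv M m E Λ r - radialF M m E Λ r) := by
  obtain ⟨CF, hCF, hF⟩ := radialF_nonneg_le (m := m) hM hm0 hmp hsum hprod hE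
  obtain ⟨ρ, c, hρ, hc, hF'⟩ := exists_le_radialFDeriv (m := m) hM hmp hsum hprod hE
  set d := ρ - rp with hd
  have hd0 : 0 < d := sub_pos.2 hρ
  set ε := c * d / (2 * (c + CF)) with hε
  have hε0 : 0 < ε := by positivity
  have hεd : (c + CF) * ε = c * d / 2 := by rw [hε]; field_simp
  have h4 : 0 ≤ d - ε := by nlinarith
  refine ⟨ρ, ε, c * d / 2, CF * d, hρ, hε0, by positivity, by positivity, ?_⟩
  intro Λ hΛ r hr
  have h3 := (hF Λ hΛ r hr).2
  refine ⟨fun hrε => ?_, fun hrρ => ?_⟩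
  · have h2 := hF' Λ hΛ r hr (by linarith)
    have h5 : (d - ε) * (c * Λ) ≤ (ρ - r) * (c * Λ) :=
      mul_le_mul_of_nonneg_right (by linarith) (by positivity)
    have h6 : CF * Λ * (r - rp) ≤ CF * Λ * ε :=
      mul_le_mul_of_nonneg_left (by linarith) (by positivity)
    calc c * d / 2 * Λ = (d - ε) * (c * Λ) - CF * Λ * ε := by linear_combination Λ * hεd
      _ ≤ (ρ - r) * (c * Λ) - CF * Λ * (r - rp) := sub_le_sub h5 h6
      _ ≤ _ := sub_le_sub (mul_le_mul_of_nonneg_left h2 (by linarith)) h3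
  · have h2 := hF' Λ hΛ r hr hrρ
    have h5 : 0 ≤ (ρ - r) * radialFDeriv M m E Λ r :=
      mul_nonneg (by linarith) ((by positivity : 0 ≤ c * Λ).trans h2)
    have h6 : CF * Λ * (r - rp) ≤ CF * Λ * d :=
      mul_le_mul_of_nonneg_left (by linarith) (by positivity)
    linarith

namespace InverseTortoise

variable {rp b : ℝ} {r g : ℝ → ℝ}

theorem continuous (hr : InverseTortoise rp b r g) : Continuous r :=
  continuous_iff_continuousAt.2 fun s => (hr.hasDeriv s).continuousAt

theorem inv_le (hr : InverseTortoise rp b r g) (hrp : 0 < rp) (s : ℝ) :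
    (g s)⁻¹ ≤ (1 + 2 * b / rp) * (r s / (r s - rp)) := by
  have hx := sub_pos.2 (hr.lt s)
  have hb := hr.b_pos
  have h1 : 2 * b ≤ 2 * b / rp * r s := by
    rw [div_mul_eq_mul_div, le_div_iff₀ hrp]
    have := hr.lt s
    gcongr
  rw [← mul_div_assoc, inv_eq_one_div, div_le_div_iff₀ (hr.g_pos s) hx, one_mul]
  refine (hr.sub_le s).trans ?_
  have := (hr.g_pos s).le
  gcongr
  linarith

theorem tendsto_sub (hr : InverseTortoise rp b r g) :
    Tendsto (fun s => r s - rp) atBot (nhds 0) := by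
  refine tendsto_order.2 ⟨fun x hx => Eventually.of_forall fun s => ?_, fun x hx => ?_⟩
  · have := hr.lt s
    linarith
  · obtain ⟨s, hs⟩ := hr.surj (rp + x) (by linarith)
    filter_upwards [eventually_lt_atBot s] with t ht
    have := hr.strictMono ht
    linarith

end InverseTortoise

namespace RadialSolution

set_option maxHeartbeats 1000000 in
theorem eventually_core_estimate {M m E rm rp b δ : ℝ} {r g : ℝ → ℝ}
    (hr : InverseTortoise rp b r g) (hM : 0 < M) (hm : 0 < m) (hm0 : 0 ≤ rm) (hmp : rm < rp)
    (hsum : rm + rp = 2 * M) (hprod : rm * rp = E ^ 2) (hE : E ^ 2 < M * rp)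
    (hδ : 0 < δ) (hδ1 : δ < 1) (S : ℝ) :
    ∃ s₁ s₂ ρ K, s₁ ≤ S - 1 ∧ S ≤ s₂ ∧ 0 < K ∧ ∀ᶠ Λ : ℝ in atTop, ∀ ω, 0 < ω → ω < m →
      ∀ H u v w, RadialSolution ω (fun s => radialF M m E Λ (r s)) H u v w → ∀ X U : ℝ,
      (∀ x y, x ≤ y → ∫ s in x..y, r s / (r s - rp) * ‖H s‖ ^ 2 ≤ X) →
      (∀ x y, 0 ≤ x → x ≤ y → ∫ s in x..y, ‖u s‖ ^ 2 ≤ U) → ∀ a ≤ s₁ - 1,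
      Λ * ((∫ s in a..s₁, g s * ‖u s‖ ^ 2) + ∫ s in s₁..s₂, ‖u s‖ ^ 2) ≤
        K * (|(ρ - r a) * (‖w a‖ ^ 2 - radialF M m E Λ (r a) * ‖u a‖ ^ 2)| +
          Real.exp (-(4 - δ) * Real.sqrt Λ * Real.log (Real.sqrt Λ)) / Λ * U + X) := by
  have hrp : 0 < rp := by linarith
  have hcr := hr.continuous
  have hcg := hr.continuous_g
  have hmono := hr.strictMono.monotone
  obtain ⟨ρ, ε, A, B, hρ, hε0, hA, hB, hAB⟩ :=
    exists_radialF_multiplier_bounds (m := m) hM hm0 hmp hsum hprod hE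
  obtain ⟨R, α, hR, hα, hfar⟩ := exists_le_radialF_sub_sq_far hmp hsum hprod hE hM hm
    (η := δ / 8) (by linarith)
  obtain ⟨sρ, hsρ⟩ := hr.surj ρ hρ
  set d := ρ - rp with hd
  have hd0 : 0 < d := sub_pos.2 hρ
  obtain ⟨s', hs'⟩ := hr.surj (rp + ε) (by linarith)
  obtain ⟨sR, hsR⟩ := hr.surj (max R (rp + 1)) (lt_max_of_lt_left hR)
  obtain ⟨Sl, hSl⟩ := hr.large
  set s₁ := min s' (min (S - 1) sρ) with hs₁
  set s₂ := max S (max sρ sR) with hs₂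
  have h1S : s₁ ≤ S - 1 := (min_le_right _ _).trans (min_le_left _ _)
  have h1ρ : s₁ ≤ sρ := (min_le_right _ _).trans (min_le_right _ _)
  have hS2 : S ≤ s₂ := le_max_left _ _
  have hρ2 : sρ ≤ s₂ := (le_max_left _ _).trans (le_max_right _ _)
  have h12 : s₁ ≤ s₂ := h1ρ.trans hρ2
  have hr2R : max R (rp + 1) ≤ r s₂ := hsR ▸ hmono ((le_max_right _ _).trans (le_max_right _ _))
  have hr2 : 1 ≤ r s₂ := by linarith [(le_max_right R (rp + 1)).trans hr2R]
  have hR2 : R ≤ r s₂ := (le_max_left _ _).trans hr2R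
  have hr1ε : ∀ s ≤ s₁, r s ≤ rp + ε := fun s hs => hs' ▸ hmono (hs.trans (min_le_left _ _))
  obtain ⟨c, Λ₁, hc, hmid⟩ := exists_le_radialF_sub_sq_of_mem_Icc (m := m) hmp hsum hprod hE hM
    (hr.lt (s₁ - 1)) (hmono (show s₁ - 1 ≤ s₂ by linarith))
  obtain ⟨sg, -, hsg⟩ := isCompact_Icc.exists_isMinOn
    (nonempty_Icc.2 (show s₁ - 1 ≤ s₁ by linarith)) hcg.continuousOn
  have hg0 := hr.g_pos sg
  have hb := hr.b_pos
  set D := (1 / c + 8 * r s₂ ^ 2) / (4 * (δ / 8)) with hD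
  have hD0 : 0 < D := by positivity
  have hD' : 4 * (δ / 8) * D = 1 / c + 8 * r s₂ ^ 2 := by rw [hD]; field_simp
  obtain ⟨K, Λ₂, hK, habs⟩ := exists_absorb_bound (A := A) (B := B)
    (t := (g sg)⁻¹) (c := (1 - δ / 8) * c) (k := d ^ 2 * (1 + 2 * b / rp)) (D := D)
    hA hB.le (by positivity) (mul_pos (by linarith) hc) (by positivity) hD0.le
  refine ⟨s₁, s₂, ρ, K, h1S, hS2, hK, ?_⟩
  filter_upwards [eventually_ge_atTop Λ₁, eventually_ge_atTop Λ₂, eventually_ge_atTop 4,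
    eventually_ge_atTop (2 * s₂ / α), eventually_ge_atTop (2 / α), eventually_ge_atTop (2 * Sl / α),
    eventually_mul_exp_le hα (zero_lt_one.trans_le hr2) hδ hδ1] with
    Λ hΛ1 hΛ2 hΛ4 hΛs hΛα hΛl hexp ω hω hωm H u v w h X U hX hU a ha
  have hΛ0 : 1 ≤ Λ := by linarith
  rw [div_le_iff₀ hα] at hΛs hΛα hΛl
  set s₃ := α * Λ / 2 with hs₃
  have hs₃0 : 0 ≤ s₃ := by positivity
  have h23 : s₂ ≤ s₃ := by linarith
  obtain ⟨hr3, -⟩ := hSl s₃ (by linarith)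
  obtain ⟨-, hr31⟩ := hSl (s₃ + 1) (by linarith)
  have hX0 : 0 ≤ X := by simpa using hX 0 0 le_rfl
  have hU0 : 0 ≤ U := by simpa using hU 0 0 le_rfl le_rfl
  have hx : ∀ s, 0 < r s - rp := fun s => sub_pos.2 (hr.lt s)
  have hqc : Continuous fun s => r s / (r s - rp) :=
    hcr.div (by fun_prop) fun s => (hx s).ne'
  have hcu := h.continuous_u
  have hcH := h.continuous_H
  have hii : ∀ {f : ℝ → ℝ}, Continuous f → ∀ x y, IntervalIntegrable f volume x y :=
    fun hf x y => hf.intervalIntegrable x y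
  have hmult := h.multiplier_estimate hr (Fr := fun s => radialFDeriv M m E Λ (r s))
    (fun s => (hasDerivAt_radialF M m E Λ (hrp.trans (hr.lt s))).comp s (hr.hasDeriv s)) hqc
    (hr.inv_le hrp) (a := a) (A := A * Λ) (B := B * Λ) (by linarith) h1ρ
    (by positivity)
    (fun s hs => hsρ ▸ (hAB Λ hΛ0 (r s) (hr.lt s)).1 (hr1ε s hs))
    (fun s _ hs => hsρ ▸ (hAB Λ hΛ0 (r s) (hr.lt s)).2 (hsρ ▸ hmono hs))
  have hsq2 : 2 ≤ Real.sqrt Λ := Real.le_sqrt_of_sq_le (by linarith)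
  have hagm := h.agmon_estimate hr (η := δ / 8) (Λ := Λ) (β := (1 - δ / 8) * Real.sqrt Λ)
    (c := c) (D := D) hrp (by linarith) (by linarith) hΛ0 (by nlinarith)
    (by rw [mul_pow, Real.sq_sqrt (by linarith)]) hc h12 h23 hr2
    (by
      rw [hD', add_mul, one_div_mul_cancel hc.ne']
      have : 0 ≤ 8 * r s₂ ^ 2 * c := by positivity
      linarith)
    (by rw [hD']; have : 0 < 1 / c := by positivity
        linarith)
    (fun s hs => hmid Λ hΛ1 ω hω hωm (r s) (hmono hs.1) (hmono hs.2))
    (fun s hs => hfar Λ (by linarith) ω hω hωm (r s) (hR2.trans (hmono hs.1))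
      ((hmono hs.2).trans (by linarith)))
  set N := ∫ s in a..s₁, g s * ‖u s‖ ^ 2 with hN
  set G := ∫ s in s₁..s₂, ‖u s‖ ^ 2 with hG
  have hG0 : 0 ≤ G := intervalIntegral.integral_nonneg h12 fun s _ => sq_nonneg _
  set o := (ρ - r a) * (‖w a‖ ^ 2 - radialF M m E Λ (r a) * ‖u a‖ ^ 2) with ho
  set κ := Real.exp (-((1 - δ / 8) * Real.sqrt Λ) * Real.log (r s₃ / r s₂)) ^ 2 with hκ
  have hfin := habs Λ hΛ2 N G |o| X (κ * U) hG0 (abs_nonneg _) hX0 (by positivity)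
    (by
      rw [hsρ, ← hd, ← ho] at hmult
      refine hmult.trans ?_
      have h1 : ∫ s in s₁..sρ, ‖u s‖ ^ 2 ≤ G :=
        intervalIntegral.integral_mono_interval le_rfl h1ρ hρ2
          (Eventually.of_forall fun x => sq_nonneg _) (hii (by fun_prop) _ _)
      have h2 := hX a sρ (by linarith)
      have h3 := le_abs_self o
      have h4 : B * Λ * (∫ s in s₁..sρ, ‖u s‖ ^ 2) ≤ B * Λ * G := by gcongr
      have h5 : d ^ 2 * (1 + 2 * b / rp) * (∫ s in a..sρ, r s / (r s - rp) * ‖H s‖ ^ 2) ≤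
        d ^ 2 * (1 + 2 * b / rp) * X := by gcongr
      linarith)
    (by
      refine hagm.trans ?_
      have h1 : ∫ s in (s₁ - 1)..s₁, ‖u s‖ ^ 2 ≤ (g sg)⁻¹ * N := by
        calc ∫ s in (s₁ - 1)..s₁, ‖u s‖ ^ 2 ≤
              ∫ s in (s₁ - 1)..s₁, (g sg)⁻¹ * (g s * ‖u s‖ ^ 2) := by
              refine intervalIntegral.integral_mono_on (by linarith) (hii (by fun_prop) _ _)
                (hii (by fun_prop) _ _) fun s hs => ?_
              have h2 : g sg ≤ g s := hsg hs
              rw [inv_mul_eq_div, le_div_iff₀ hg0, mul_comm]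
              gcongr
          _ = (g sg)⁻¹ * ∫ s in (s₁ - 1)..s₁, g s * ‖u s‖ ^ 2 := by
              rw [intervalIntegral.integral_const_mul]
          _ ≤ _ := by
              gcongr
              exact intervalIntegral.integral_mono_interval ha (by linarith) le_rfl
                (Eventually.of_forall fun s => by
                  have := hr.g_pos s
                  simp only [Pi.zero_apply]
                  positivity) (hii (by fun_prop) _ _)
      have h2 := hU s₃ (s₃ + 1) hs₃0 (by linarith)
      have h3 : ∫ s in (s₁ - 1)..(s₃ + 1), ‖H s‖ ^ 2 ≤ X := by
        refine le_trans ?_ (hX (s₁ - 1) (s₃ + 1) (by linarith))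
        refine intervalIntegral.integral_mono_on (by linarith) (hii (by fun_prop) _ _)
          (hii (by fun_prop) _ _) fun s _ => ?_
        refine le_mul_of_one_le_left (sq_nonneg _) ?_
        rw [one_le_div (hx s)]
        linarith
      have hκ0 : 0 ≤ κ := by positivity
      gcongr)
  refine hfin.trans ?_
  have hκΛ : κ ≤ Real.exp (-(4 - δ) * Real.sqrt Λ * Real.log (Real.sqrt Λ)) / Λ := by
    rw [le_div_iff₀ (by linarith), mul_comm]
    exact hexp (r s₃) (by linarith)
  gcongr

theorem exists_local_energy_bound {M m E rm rp b δ S Iw : ℝ} {r g θ : ℝ → ℝ}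
    (hr : InverseTortoise rp b r g) (hM : 0 < M) (hm : 0 < m) (hm0 : 0 ≤ rm) (hmp : rm < rp)
    (hsum : rm + rp = 2 * M) (hprod : rm * rp = E ^ 2) (hE : E ^ 2 < M * rp)
    (hδ : 0 < δ) (hδ1 : δ < 1) (hθc : Continuous θ) (hθ0 : ∀ s, 0 ≤ θ s) (hθ1 : ∀ s, θ s ≤ 1)
    (hIw : 0 ≤ Iw) (hθI : ∀ a ≤ S - 1, ∫ s in a..(S - 1), θ s ≤ Iw) :
    ∃ K, 0 < K ∧ ∀ᶠ Λ : ℝ in atTop, ∀ ω, 0 < ω → ω < m →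
      ∀ H u v w, RadialSolution ω (fun s => radialF M m E Λ (r s)) H u v w →
      Tendsto w atBot (nhds 0) → (∃ c, ∀ᶠ s in atBot, ‖u s‖ ≤ c) → ∀ X U : ℝ,
      (∀ x y, x ≤ y → ∫ s in x..y, r s / (r s - rp) * ‖H s‖ ^ 2 ≤ X) →
      (∀ x y, 0 ≤ x → x ≤ y → ∫ s in x..y, ‖u s‖ ^ 2 ≤ U) → ∀ a ≤ S - 1,
      ∫ s in a..S, (r s / (r s - rp) * ‖w s‖ ^ 2 + θ s * (‖v s‖ ^ 2 + ‖u s‖ ^ 2)) ≤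
        K * (Real.exp (-(4 - δ) * Real.sqrt Λ * Real.log (Real.sqrt Λ)) * U + Λ * X) := by
  have hrp : 0 < rp := by linarith
  have hb := hr.b_pos
  have hx : ∀ s, 0 < r s - rp := fun s => sub_pos.2 (hr.lt s)
  have hcr := hr.continuous
  have hcg := hr.continuous_g
  have hqc : Continuous fun s => r s / (r s - rp) :=
    hcr.div (by fun_prop) fun s => (hx s).ne'
  obtain ⟨CF, hCF, hF⟩ := radialF_nonneg_le (m := m) hM hm0 hmp hsum hprod hE
  obtain ⟨s₁, s₂, ρ, K, h1S, hS2, hK, hcore⟩ :=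
    eventually_core_estimate hr hM hm hm0 hmp hsum hprod hE hδ hδ1 S
  set Y := r S - rp + 2 * b with hY
  have hY0 : 0 < Y := by have := hx S; positivity
  have hxY : ∀ s ≤ S, r s - rp ≤ Y * g s := fun s hs => by
    refine (hr.sub_le s).trans (mul_le_mul_of_nonneg_right ?_ (hr.g_pos s).le)
    have := hr.strictMono.monotone hs
    linarith
  have hrS : 0 < r S := hrp.trans (hr.lt S)
  set Cw := Y ^ 2 + r S * Y with hCw
  have hCw0 : 0 < Cw := by positivity
  set Cq := 1 + 2 * b / rp with hCq
  have hCq0 : 0 < Cq := by positivity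
  set Z := 3 * Cw + (2 * m ^ 2 + 1) * (Iw * Real.exp (r S - rp) * (1 + Cw) + 1) with hZ
  have hZ0 : 0 < Z := by positivity
  refine ⟨Z * (32 * (CF ^ 2 * Y ^ 2) * K + 32 * Cq + K), by positivity, ?_⟩
  filter_upwards [hcore, eventually_ge_atTop 1] with Λ hcore hΛ ω hω hωm H u v w h hw hu X U hX hU
    a ha
  have hX0 : 0 ≤ X := by simpa using hX 0 0 le_rfl
  have hU0 : 0 ≤ U := by simpa using hU 0 0 le_rfl le_rfl
  have ho : Tendsto (fun a => |(ρ - r a) * (‖w a‖ ^ 2 - radialF M m E Λ (r a) * ‖u a‖ ^ 2)|)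
      atBot (nhds 0) := by
    obtain ⟨c, hc⟩ := hu
    have h1 : Tendsto (fun a => radialF M m E Λ (r a) * ‖u a‖ ^ 2) atBot (nhds 0) := by
      refine squeeze_zero' (Eventually.of_forall fun s => mul_nonneg
        (hF Λ hΛ (r s) (hr.lt s)).1 (sq_nonneg _)) (g := fun s => CF * Λ * (r s - rp) * c ^ 2) ?_
        (by simpa using (hr.tendsto_sub.const_mul (CF * Λ)).mul_const (c ^ 2))
      filter_upwards [hc] with s hs
      have h2 := (hF Λ hΛ (r s) (hr.lt s)).2
      have h3 := (hF Λ hΛ (r s) (hr.lt s)).1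
      have h4 := h3.trans h2
      gcongr
    have h2 : Tendsto (fun a => ρ - r a) atBot (nhds (ρ - rp)) := by
      have := hr.tendsto_sub.const_sub (ρ - rp)
      simpa using this
    simpa using (h2.mul ((hw.norm.pow 2).sub h1)).abs
  have hWB := h.weighted_estimate_of_core hr hqc (Cq := Cq) (C := CF ^ 2 * Y ^ 2) (K := K) (Λ := Λ)
    (P := Real.exp (-(4 - δ) * Real.sqrt Λ * Real.log (Real.sqrt Λ)) / Λ * U) (X := X) (a₀ := a)
    (hr.inv_le hrp)
    (by
      intro s hs
      obtain ⟨h1, h2⟩ := hF Λ hΛ (r s) (hr.lt s)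
      have h3 : radialF M m E Λ (r s) ≤ CF * Λ * (Y * g s) := by
        refine h2.trans ?_
        have := hxY s hs
        gcongr
      calc radialF M m E Λ (r s) ^ 2 ≤ (CF * Λ * (Y * g s)) ^ 2 := by gcongr
        _ = _ := by ring)
    hCq0.le (by positivity) hK.le hΛ (by positivity) hX0 h1S hS2 hw ho
    (hcore ω hω hωm H u v w h X U hX hU) (fun a ha => hX a S ha) (by linarith)
  have hloc := h.local_bound hr hqc (m := m) (Cw := Cw) (Iw := Iw) (a₀ := a) (S := S)
    (G := fun s => g s / (r s - rp) ^ 2) (θ := θ) hω hωm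
    (hcg.div (by fun_prop) fun s => by have := hx s; positivity) hCw0.le
    (by
      intro s hs
      have h1 := hx s
      have h2 := hr.g_pos s
      have h3 : (r s - rp) ^ 2 ≤ Y ^ 2 * g s ^ 2 := by
        rw [← mul_pow]
        have := hxY s hs
        gcongr
      rw [← mul_div_assoc, inv_eq_one_div, div_le_div_iff₀ h2 (by positivity), hCw]
      have : 0 ≤ r S * Y * g s * g s := by positivity
      linarith)
    (by
      intro s hs
      have h1 := hx s
      have h2 := hr.g_pos s
      have h3 : r s * (r s - rp) ≤ r S * (Y * g s) :=
        mul_le_mul (hr.strictMono.monotone hs) (hxY s hs) h1.le hrS.le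
      have h4 : 0 ≤ Y ^ 2 * g s := by positivity
      calc r s / (r s - rp) = r s * (r s - rp) / (r s - rp) ^ 2 := by field_simp
        _ ≤ Cw * g s / (r s - rp) ^ 2 := by
          refine div_le_div_of_nonneg_right ?_ (sq_nonneg _)
          rw [hCw]
          linarith
        _ = _ := by rw [mul_div_assoc])
    hθc hθ0 hθ1 (hθI a ha) ha
  refine hloc.trans ?_
  calc _ ≤ Z * ((32 * (CF ^ 2 * Y ^ 2) * K + 32 * Cq + K) * Λ *
        (Real.exp (-(4 - δ) * Real.sqrt Λ * Real.log (Real.sqrt Λ)) / Λ * U + X)) :=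
        mul_le_mul_of_nonneg_left hWB hZ0.le
    _ = _ := by
        field_simp

end RadialSolution

theorem integrableOn_Iic_weight {p : ℝ} (hp : 1 < p) (a : ℝ) :
    IntegrableOn (fun s : ℝ => ((max 0 (-s)) ^ p + 1)⁻¹) (Iic a) := by
  have hc : Continuous fun s : ℝ => ((max 0 (-s)) ^ p + 1)⁻¹ := by
    refine Continuous.inv₀ ?_ fun s => by positivity
    exact ((continuous_const.max continuous_neg).rpow_const fun s =>
      Or.inr (by linarith)).add_const 1
  have hi : Integrable (fun s : ℝ => (1 + ‖s‖) ^ (-p)) :=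
    integrable_one_add_norm (by simpa using hp)
  refine (hc.locallyIntegrable.locallyIntegrableOn _).integrableOn_of_isBigO_atBot ?_
    (hi.integrableAtFilter atBot)
  refine Asymptotics.IsBigO.of_bound (2 ^ p) ?_
  filter_upwards [eventually_le_atBot (-1)] with s hs
  rw [max_eq_right (by linarith), Real.norm_of_nonneg (by have : 0 ≤ -s := by linarith
                                                          positivity),
    Real.norm_of_nonneg (by positivity), Real.norm_eq_abs, abs_of_neg (by linarith),
    Real.rpow_neg (by linarith), ← div_eq_mul_inv, inv_eq_one_div,
    div_le_div_iff₀ (by have : 0 ≤ -s := by linarith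
                        positivity) (Real.rpow_pos_of_pos (by linarith) _)]
  calc 1 * (1 + -s) ^ p ≤ (2 * -s) ^ p := by
        rw [one_mul]
        exact Real.rpow_le_rpow (by linarith) (by linarith) (by linarith)
    _ = 2 ^ p * (-s) ^ p := Real.mul_rpow (by norm_num) (by linarith)
    _ ≤ _ := by gcongr; linarith

theorem intervalIntegral_le_toReal_setLIntegral {f : ℝ → ℝ} {T : Set ℝ} {x y : ℝ}
    (hf : Continuous f) (hf0 : ∀ s, 0 ≤ f s) (hxy : x ≤ y) (hT : Ioc x y ⊆ T)
    (hfin : ∫⁻ s in T, ENNReal.ofReal (f s) ≠ ⊤) :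
    ∫ s in x..y, f s ≤ (∫⁻ s in T, ENNReal.ofReal (f s)).toReal := by
  rw [intervalIntegral.integral_of_le hxy, integral_eq_lintegral_of_nonneg_ae
    (Eventually.of_forall hf0) hf.aestronglyMeasurable.restrict]
  exact ENNReal.toReal_mono hfin (lintegral_mono_set hT)

theorem setLIntegral_Iic_le_ofReal {f : ℝ → ℝ} {S c : ℝ} (hf : Continuous f)
    (hf0 : ∀ s, 0 ≤ f s) (h : ∀ᶠ a in atBot, ∫ s in a..S, f s ≤ c) :
    ∫⁻ s in Iic S, ENNReal.ofReal (f s) ≤ ENNReal.ofReal c := by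
  have hi : IntegrableOn f (Iic S) := by
    refine integrableOn_Iic_of_intervalIntegral_norm_bounded c S (a := id)
      (fun a => (hf.integrableOn_Icc).mono_set Ioc_subset_Icc_self) tendsto_id ?_
    simpa only [Real.norm_of_nonneg (hf0 _), id] using h
  rw [← ofReal_integral_eq_lintegral_ofReal hi (Eventually.of_forall hf0)]
  exact ENNReal.ofReal_le_ofReal
    (le_of_tendsto (intervalIntegral_tendsto_integral_Iic S hi tendsto_id) h)

theorem Vpot_eq_radialF (M m E : ℝ) (r : ℝ → ℝ) (ω : ℝ) (L : ℕ) (s : ℝ) :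
    Vpot M m E r ω L s = radialF M m E ((L : ℝ) * ((L : ℝ) + 1)) (r s) - ω ^ 2 := by
  unfold Vpot radialF
  ring

theorem WeaklyOutgoing.tendsto_atBot {ω : ℝ} {u : ℝ → ℂ} (h : WeaklyOutgoing ω u) :
    Tendsto (fun s => deriv u s + Complex.I * (ω : ℂ) * u s) atBot (nhds 0) ∧
      ∃ c, ∀ᶠ s in atBot, ‖u s‖ ≤ c := by
  obtain ⟨⟨c, h1, h2⟩, -⟩ := h
  constructor
  · have h3 := h2.add (h1.const_mul (Complex.I * (ω : ℂ)))
    simp only [mul_zero, add_zero] at h3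
    refine h3.congr fun s => ?_
    ring
  · refine ⟨1 + ‖c‖, ?_⟩
    filter_upwards [h1.norm.eventually (eventually_le_nhds (show ‖(0 : ℂ)‖ < 1 by simp))] with s hs
    have h3 : ‖c * Complex.exp (-Complex.I * (ω : ℂ) * (s : ℂ))‖ = ‖c‖ := by
      rw [norm_mul, Complex.norm_exp]
      simp
    have h4 := norm_sub_norm_le (u s) (c * Complex.exp (-Complex.I * (ω : ℂ) * (s : ℂ)))
    linarith

/-- Agmon-type estimate: control on (-inf, S0] in terms of an exponentially small
multiple of the L^2 norm of u on (0, inf) plus the source. -/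
theorem statement8
    (M m E : ℝ) (hM : 0 < M) (hm : 0 < m) (hE : |E| < M)
    (rm rp κ : ℝ)
    (hrm : rm = M - Real.sqrt (M ^ 2 - E ^ 2))
    (hrp : rp = M + Real.sqrt (M ^ 2 - E ^ 2))
    (hκ : κ = (M * rp - E ^ 2) / rp ^ 3)
    (rofs : ℝ → ℝ)
    (hr1 : ∀ s : ℝ, rp < rofs s)
    (hr2 : ∀ s : ℝ, rofs s + (2 * κ)⁻¹ * Real.log ((rofs s - rm) * (rofs s - rp)) = s) :
    ∀ p : ℕ, 2 ≤ p → ∀ C₁ : ℝ, 0 < C₁ →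
    ∀ δ₁ : ℝ, δ₁ ∈ Set.Ioo (0 : ℝ) 1 → ∀ δt : ℝ, δt ∈ Set.Ioo (0 : ℝ) 1 →
    ∀ S₀ : ℝ, 0 < S₀ →
    ∃ C : ℝ, 0 < C ∧ ∃ L₀ : ℕ, ∀ L : ℕ, L₀ ≤ L →
    ∀ ω : ℝ, 0 < ω → ω < m →
      ((L : ℝ) ^ p)⁻¹ ≤ m ^ 2 - ω ^ 2 → m ^ 2 - ω ^ 2 ≤ C₁ * ((L : ℝ) ^ 2)⁻¹ →
    ∀ H u : ℝ → ℂ, Continuous H → ContDiff ℝ 2 u →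
    (∀ s : ℝ, deriv (deriv u) s - (Vpot M m E rofs ω L s : ℂ) * u s = H s) →
    WeaklyOutgoing ω u →
    (∫⁻ s in Set.Iic S₀,
        ENNReal.ofReal (rofs s / (rofs s - rp) * ‖deriv u s + Complex.I * (ω : ℂ) * u s‖ ^ 2
          + ((max 0 (-s)) ^ (1 + δ₁) + 1)⁻¹ * (‖deriv u s‖ ^ 2 + ‖u s‖ ^ 2)))
      ≤ ENNReal.ofReal C *
        (ENNReal.ofReal (Real.exp (-(4 - δt) * Real.sqrt ((L : ℝ) * ((L : ℝ) + 1)) *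
              Real.log (Real.sqrt ((L : ℝ) * ((L : ℝ) + 1))))) *
            (∫⁻ s in Set.Ioi (0 : ℝ), ENNReal.ofReal (‖u s‖ ^ 2))
          + ENNReal.ofReal (Real.sqrt ((L : ℝ) * ((L : ℝ) + 1)) ^ 2) *
            ∫⁻ s : ℝ, ENNReal.ofReal (rofs s / (rofs s - rp) * ‖H s‖ ^ 2)) := by
  intro p _ C₁ _ δ₁ hδ₁ δt hδt S₀ _
  have hE2 : 0 < M ^ 2 - E ^ 2 := by
    have := sq_lt_sq' (neg_lt_of_abs_lt hE) (lt_of_abs_lt hE)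
    linarith
  set d := Real.sqrt (M ^ 2 - E ^ 2) with hd
  have hd0 : 0 < d := Real.sqrt_pos.2 hE2
  have hdd : d ^ 2 = M ^ 2 - E ^ 2 := Real.sq_sqrt hE2.le
  have hm0 : 0 ≤ rm := by nlinarith [sq_nonneg E]
  have hmp : rm < rp := by linarith
  have hsum : rm + rp = 2 * M := by linarith
  have hprod : rm * rp = E ^ 2 := by rw [hrm, hrp]; linarith
  have hEM : E ^ 2 < M * rp := by rw [hrp]; nlinarith
  have hrp0 : 0 < rp := by linarith
  have hb : 0 < (2 * κ)⁻¹ := by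
    have : 0 < κ := hκ ▸ div_pos (by linarith) (by positivity)
    positivity
  obtain ⟨g, hr⟩ := inverseTortoise_of_rightInverse hm0 hmp hb hr1 hr2
  have hp : 1 < 1 + δ₁ := by linarith [hδ₁.1]
  have hθpos : ∀ s : ℝ, 0 < (max 0 (-s)) ^ (1 + δ₁) + 1 := fun s => by positivity
  have hθc : Continuous fun s : ℝ => ((max 0 (-s)) ^ (1 + δ₁) + 1)⁻¹ :=
    (((continuous_const.max continuous_neg).rpow_const fun s =>
      Or.inr (by linarith)).add_const 1).inv₀ fun s => (hθpos s).ne'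
  have hθ0 : ∀ s : ℝ, 0 ≤ ((max 0 (-s)) ^ (1 + δ₁) + 1)⁻¹ := fun s => (inv_pos.2 (hθpos s)).le
  obtain ⟨K, hK, hev⟩ := RadialSolution.exists_local_energy_bound (S := S₀) hr hM hm hm0 hmp hsum
    hprod hEM hδt.1 hδt.2 hθc hθ0
    (fun s => inv_le_one_of_one_le₀ (by
      have : 0 ≤ (max 0 (-s)) ^ (1 + δ₁) := by positivity
      linarith))
    (setIntegral_nonneg measurableSet_Iic fun s _ => hθ0 s)
    (fun a ha => by
      rw [intervalIntegral.integral_of_le ha]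
      exact setIntegral_mono_set (integrableOn_Iic_weight hp (S₀ - 1))
        (Eventually.of_forall hθ0) Ioc_subset_Iic_self.eventuallyLE)
  have hL : Tendsto (fun L : ℕ => (L : ℝ) * ((L : ℝ) + 1)) atTop atTop :=
    tendsto_natCast_atTop_atTop.atTop_mul_atTop₀
      (tendsto_atTop_add_const_right _ _ tendsto_natCast_atTop_atTop)
  obtain ⟨L₀, hL₀⟩ := eventually_atTop.1 (hL.eventually (hev.and (eventually_gt_atTop 0)))
  refine ⟨K, hK, L₀, fun L hLL ω hω hωm _ _ H u hH hu heq hout => ?_⟩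
  obtain ⟨hest, hΛ⟩ := hL₀ L hLL
  set Λ := (L : ℝ) * ((L : ℝ) + 1) with hΛdef
  rw [Real.sq_sqrt hΛ.le]
  set dec := Real.exp (-(4 - δt) * Real.sqrt Λ * Real.log (Real.sqrt Λ)) with hdec
  have hdec0 : 0 < dec := Real.exp_pos _
  have hcr := hr.continuous
  have hx : ∀ s, 0 < rofs s - rp := fun s => sub_pos.2 (hr1 s)
  have hr0 : ∀ s, 0 < rofs s := fun s => hrp0.trans (hr1 s)
  have hqc : Continuous fun s => rofs s / (rofs s - rp) :=
    hcr.div (by fun_prop) fun s => (hx s).ne'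
  have hq0 : ∀ s, 0 ≤ rofs s / (rofs s - rp) := fun s => (div_pos (hr0 s) (hx s)).le
  by_cases hXt : ∫⁻ s : ℝ, ENNReal.ofReal (rofs s / (rofs s - rp) * ‖H s‖ ^ 2) = ⊤
  · rw [hXt, ENNReal.mul_top (by simpa using hΛ), add_top, ENNReal.mul_top (by simpa using hK)]
    exact le_top
  by_cases hUt : ∫⁻ s in Ioi (0 : ℝ), ENNReal.ofReal (‖u s‖ ^ 2) = ⊤
  · rw [hUt, ENNReal.mul_top (by simpa using hdec0), top_add, ENNReal.mul_top (by simpa using hK)]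
    exact le_top
  have hdu : ∀ s, HasDerivAt u (deriv u s) s := fun s =>
    (hu.differentiable (by norm_num) s).hasDerivAt
  have hdv : ∀ s, HasDerivAt (deriv u) (deriv (deriv u) s) s := fun s =>
    ((hu.iterate_deriv' 1 1).differentiable (by norm_num) s).hasDerivAt
  have hsol : RadialSolution ω (fun s => radialF M m E Λ (rofs s)) H u (deriv u)
      (fun s => deriv u s + Complex.I * (ω : ℂ) * u s) :=
    ⟨hH, hdu, fun s => (hdv s).congr_deriv (by
      rw [← Vpot_eq_radialF, ← heq s]; ring), fun s => rfl⟩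
  obtain ⟨hw, hub⟩ := hout.tendsto_atBot
  have hcu := hsol.continuous_u
  have hcv := hsol.continuous_v
  have hbound := hest ω hω hωm H u _ _ hsol hw hub
    (∫⁻ s : ℝ, ENNReal.ofReal (rofs s / (rofs s - rp) * ‖H s‖ ^ 2)).toReal
    (∫⁻ s in Ioi (0 : ℝ), ENNReal.ofReal (‖u s‖ ^ 2)).toReal
    (fun x y hxy => by
      rw [← setLIntegral_univ] at hXt ⊢
      exact intervalIntegral_le_toReal_setLIntegral (by fun_prop)
        (fun s => mul_nonneg (hq0 s) (sq_nonneg _)) hxy (subset_univ _) hXt)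
    (fun x y hx hxy => intervalIntegral_le_toReal_setLIntegral (by fun_prop)
      (fun s => sq_nonneg _) hxy (fun s hs => hx.trans_lt hs.1) hUt)
  refine (setLIntegral_Iic_le_ofReal (by fun_prop) (fun s => ?_)
    ((eventually_le_atBot (S₀ - 1)).mono hbound)).trans_eq ?_
  · exact add_nonneg (mul_nonneg (hq0 s) (sq_nonneg _)) (mul_nonneg (hθ0 s) (by positivity))
  · rw [ENNReal.ofReal_mul hK.le, ENNReal.ofReal_add (by positivity) (by positivity),
      ENNReal.ofReal_mul hdec0.le, ENNReal.ofReal_mul hΛ.le, ENNReal.ofReal_toReal hUt,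
      ENNReal.ofReal_toReal hXt]
end
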